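/- With the above hypotheses, the projective dimension of S/J as an S-module equals m. -/

import Mathlib

open MvPolynomial

noncomputable section

/-- The bigraded polynomial ring `S = k[x₁,…,xₙ,y₁,…,y_p]`. -/
abbrev PolyS (k : Type) [Field k] (n p : ℕ) : Type := MvPolynomial (Fin n ⊕ Fin p) k

/-- The bigrading with `deg xᵢ = (1,0)` and `deg yⱼ = (0,1)`. -/
def bideg (n p : ℕ) : (Fin n ⊕ Fin p) → ℤ × ℤ :=
  Sum.elim (fun _ => ((1 : ℤ), (0 : ℤ))) (fun _ => ((0 : ℤ), (1 : ℤ)))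

/-- The bihomogeneous component of `S` of bidegree `d`. -/
def piece (k : Type) [Field k] (n p : ℕ) (d : ℤ × ℤ) : Submodule k (PolyS k n p) :=
  weightedHomogeneousSubmodule k (bideg n p) d

/-- The sequence `z` defined by `[z₁ … z_m] = [x₁ … xₙ]·φ`. -/
def zseq (k : Type) [Field k] (n m p : ℕ) (φ : Matrix (Fin n) (Fin m) (PolyS k n p))
    (j : Fin m) : PolyS k n p :=
  ∑ i : Fin n, X (Sum.inl i) * φ i j

/-- The ideal of `t × t` minors of a matrix. -/
def minorsIdeal {R : Type} [CommRing R] {a b : ℕ} (t : ℕ) (φ : Matrix (Fin a) (Fin b) R) :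
    Ideal R :=
  Ideal.span { d : R | ∃ (r : Fin t ↪ Fin a) (c : Fin t ↪ Fin b),
    d = (φ.submatrix r c).det }

/-- `J = (z₁,…,z_m) + Iₙ(φ)`. -/
def resJ (k : Type) [Field k] (n m p : ℕ) (φ : Matrix (Fin n) (Fin m) (PolyS k n p)) :
    Ideal (PolyS k n p) :=
  Ideal.span (Set.range (zseq k n m p φ)) ⊔ minorsIdeal n φ

/-- The height of an ideal. -/
def idealHeight {R : Type} [CommRing R] (I : Ideal R) : ℕ∞ :=
  ⨅ (P : PrimeSpectrum R) (_ : I ≤ P.asIdeal), Order.height P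

/-- `grade I ≥ t`: there is a regular sequence of length `t` inside `I`. -/
def gradeGE {R : Type} [CommRing R] (I : Ideal R) (t : ℕ) : Prop :=
  ∃ rs : List R, rs.length = t ∧ (∀ r ∈ rs, r ∈ I) ∧ RingTheory.Sequence.IsRegular R rs

/-- The ideal `(x₁,…,xₙ)` of `S`. -/
def xIdeal (k : Type) [Field k] (n p : ℕ) : Ideal (PolyS k n p) :=
  Ideal.span (Set.range fun i : Fin n => (X (Sum.inl i) : PolyS k n p))

/-- The geometric residual intersection condition: `(z)_𝔭 = (x)_𝔭` for all primes
`𝔭 ⊇ (x)` of height at most `m`. -/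
def geomResCond (k : Type) [Field k] (n m p : ℕ)
    (φ : Matrix (Fin n) (Fin m) (PolyS k n p)) : Prop :=
  ∀ P : PrimeSpectrum (PolyS k n p), xIdeal k n p ≤ P.asIdeal →
    Order.height P ≤ (m : ℕ∞) →
    Ideal.map (algebraMap (PolyS k n p) (Localization.AtPrime P.asIdeal))
        (Ideal.span (Set.range (zseq k n m p φ)))
      = Ideal.map (algebraMap (PolyS k n p) (Localization.AtPrime P.asIdeal))
          (xIdeal k n p)

/-- `M` has a free resolution of length at most `t` over `R`:
`0 → F_t → ⋯ → F_0 → M → 0` with each `F_i` free.  Over a polynomial ring over a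
field this is equivalent to `projdim M ≤ t` (for finitely generated `M`). -/
def HasFreeResLE (R : Type) [CommRing R] (M : Type) [AddCommGroup M] [Module R M]
    (t : ℕ) : Prop :=
  ∃ (σ : ℕ → Type) (f : ∀ i : ℕ, ((σ (i + 1)) →₀ R) →ₗ[R] ((σ i) →₀ R))
    (π : ((σ 0) →₀ R) →ₗ[R] M),
    Function.Surjective π ∧ Function.Exact (f 0) π ∧
    (∀ i, Function.Exact (f (i + 1)) (f i)) ∧
    (∀ i, t < i → IsEmpty (σ i))

section ExtAlgebra

open CategoryTheory Abelian

variable {R : Type} [CommRing R]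

/-- The projective dimension of the module `M` is less than `n`. -/
abbrev PdLT (R : Type) [CommRing R] (M : Type) [AddCommGroup M] [Module R M] (n : ℕ) : Prop :=
  HasProjectiveDimensionLT (ModuleCat.of R M) n

/-- `Ext^i(M, N) = 0`. -/
abbrev ExtZero (R : Type) [CommRing R] (M N : Type) [AddCommGroup M] [Module R M]
    [AddCommGroup N] [Module R N] (i : ℕ) : Prop :=
  Subsingleton (Ext (ModuleCat.of R M) (ModuleCat.of R N) i)

variable {A B C D M N : Type} [AddCommGroup A] [AddCommGroup B] [AddCommGroup C] [AddCommGroup D]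
  [AddCommGroup M] [AddCommGroup N]
  [Module R A] [Module R B] [Module R C] [Module R D] [Module R M] [Module R N]

/-- The short complex of modules attached to two linear maps with composite zero. -/
abbrev linShort (f : A →ₗ[R] B) (g : B →ₗ[R] C) (h : Function.Exact f g) :
    ShortComplex (ModuleCat.{0} R) :=
  ShortComplex.mk (ModuleCat.ofHom f) (ModuleCat.ofHom g)
    (by ext x; simpa using h.apply_apply_eq_zero x)

lemma linShort_shortExact {f : A →ₗ[R] B} {g : B →ₗ[R] C} (h : Function.Exact f g)
    (hf : Function.Injective f) (hg : Function.Surjective g) :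
    (linShort f g h).ShortExact := by
  refine ShortComplex.ShortExact.mk' (ModuleCat.shortComplex_exact _ h) ?_ ?_
  · rw [ModuleCat.mono_iff_injective]; exact hf
  · rw [ModuleCat.epi_iff_surjective]; exact hg

lemma pdLT_mono {a b : ℕ} (hab : a ≤ b) (h : PdLT R M a) : PdLT R M b :=
  hasProjectiveDimensionLT_of_ge _ a b hab

lemma pdLT_of_equiv (e : M ≃ₗ[R] N) {a : ℕ} (h : PdLT R M a) : PdLT R N a :=
  hasProjectiveDimensionLT_of_iso e.toModuleIso a

lemma pdLT_left {f : A →ₗ[R] B} {g : B →ₗ[R] C} (h : Function.Exact f g)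
    (hf : Function.Injective f) (hg : Function.Surjective g) {n : ℕ}
    (hB : PdLT R B n) (hC : PdLT R C (n + 1)) : PdLT R A n :=
  (linShort_shortExact h hf hg).hasProjectiveDimensionLT_X₁ n hB hC

lemma pdLT_mid {f : A →ₗ[R] B} {g : B →ₗ[R] C} (h : Function.Exact f g)
    (hf : Function.Injective f) (hg : Function.Surjective g) {n : ℕ}
    (hA : PdLT R A n) (hC : PdLT R C n) : PdLT R B n :=
  (linShort_shortExact h hf hg).hasProjectiveDimensionLT_X₂ n hA hC

lemma pdLT_right {f : A →ₗ[R] B} {g : B →ₗ[R] C} (h : Function.Exact f g)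
    (hf : Function.Injective f) (hg : Function.Surjective g) {n : ℕ}
    (hA : PdLT R A n) (hB : PdLT R B (n + 1)) : PdLT R C (n + 1) :=
  (linShort_shortExact h hf hg).hasProjectiveDimensionLT_X₃ n hA hB

lemma pdLT_one_iff : PdLT R M 1 ↔ Module.Projective R M := by
  rw [PdLT, ← projective_iff_hasProjectiveDimensionLT_one, IsProjective.iff_projective]

lemma pdLT_of_projective [Module.Projective R M] {a : ℕ} (ha : 1 ≤ a) : PdLT R M a :=
  pdLT_mono ha (pdLT_one_iff.2 inferInstance)

lemma pdLT_zero_iff : PdLT R M 0 ↔ Subsingleton M := by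
  rw [PdLT, hasProjectiveDimensionLT_zero_iff_isZero, ModuleCat.isZero_iff_subsingleton]

lemma pdLT_pi {a : ℕ} (r : ℕ) (h : PdLT R M a) : PdLT R (Fin r → M) a := by
  induction r with
  | zero => exact pdLT_mono (Nat.zero_le _) (pdLT_zero_iff.2 inferInstance)
  | succ r ih =>
    have e := Fin.consLinearEquiv R (fun _ : Fin (r + 1) => M)
    refine pdLT_of_equiv e ?_
    exact pdLT_mid (f := LinearMap.inl R M (Fin r → M)) (g := LinearMap.snd R M (Fin r → M))
      Function.Exact.inl_snd LinearMap.inl_injective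
      LinearMap.snd_surjective h ih

lemma pdLT_pi_fintype {ι : Type} [Finite ι] {a : ℕ} (h : PdLT R M a) : PdLT R (ι → M) a := by
  obtain ⟨r, ⟨e⟩⟩ := Finite.exists_equiv_fin ι
  exact pdLT_of_equiv (LinearEquiv.funCongrLeft R M e) (pdLT_pi r h)

lemma ExtZero.of_pdLT {a i : ℕ} (h : PdLT R M a) (hi : a ≤ i) : ExtZero R M N i :=
  HasProjectiveDimensionLT.subsingleton _ a i hi _

lemma ofHom_symm_comp_ofHom (e : A ≃ₗ[R] B) :
    ModuleCat.ofHom (e.symm : B →ₗ[R] A) ≫ ModuleCat.ofHom (e : A →ₗ[R] B) = 𝟙 _ := by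
  ext; simp

lemma ExtZero.of_equiv_right (e : A ≃ₗ[R] B) {i : ℕ} (h : ExtZero R M A i) : ExtZero R M B i := by
  refine ⟨fun x y => ?_⟩
  have key : ∀ z : Ext (ModuleCat.of R M) (ModuleCat.of R B) i, z = 0 := fun z => by
    have h1 := h.elim (z.comp (Ext.mk₀ e.toModuleIso.inv) (add_zero i)) 0
    have h2 := congrArg (fun w => Ext.comp w (Ext.mk₀ e.toModuleIso.hom) (add_zero i)) h1
    simpa [Ext.comp_assoc_of_third_deg_zero, ofHom_symm_comp_ofHom] using h2
  rw [key x, key y]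

lemma ExtZero.iff_zero {i : ℕ} :
    ExtZero R M N i ↔ ∀ x : Ext (ModuleCat.of R M) (ModuleCat.of R N) i, x = 0 :=
  ⟨fun h x => h.elim _ _, fun h => ⟨fun x y => by rw [h x, h y]⟩⟩

variable {f : A →ₗ[R] B} {g : B →ₗ[R] C}

lemma ExtZero.cov_mid (h : Function.Exact f g)
    (hf : Function.Injective f) (hg : Function.Surjective g) {i : ℕ}
    (hA : ExtZero R M A i) (hC : ExtZero R M C i) : ExtZero R M B i := by
  rw [ExtZero.iff_zero] at *
  intro x
  obtain ⟨y, rfl⟩ := Ext.covariant_sequence_exact₂ _ (linShort_shortExact h hf hg) x (hC _)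
  rw [hA y, Ext.zero_comp]

lemma ExtZero.cov_right (h : Function.Exact f g)
    (hf : Function.Injective f) (hg : Function.Surjective g) {i : ℕ}
    (hB : ExtZero R M B i) (hA : ExtZero R M A (i + 1)) : ExtZero R M C i := by
  rw [ExtZero.iff_zero] at *
  intro x
  obtain ⟨y, rfl⟩ := Ext.covariant_sequence_exact₃ _ (linShort_shortExact h hf hg) x rfl (hA _)
  rw [hB y, Ext.zero_comp]

lemma ExtZero.contra_left (h : Function.Exact f g)
    (hf : Function.Injective f) (hg : Function.Surjective g) {i : ℕ}
    (hB : ExtZero R B M i) (hC : ExtZero R C M (i + 1)) : ExtZero R A M i := by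
  rw [ExtZero.iff_zero] at *
  intro x
  obtain ⟨y, rfl⟩ := Ext.contravariant_sequence_exact₁ (linShort_shortExact h hf hg) _ x
    (add_comm 1 i) (hC _)
  rw [hB y, Ext.comp_zero]

lemma ExtZero.linearMap_eq_zero (h : ExtZero R M N 0) (φ : M →ₗ[R] N) : φ = 0 := by
  rw [ExtZero.iff_zero] at h
  have := h (Ext.mk₀ (ModuleCat.ofHom φ))
  rw [Ext.mk₀_eq_zero_iff] at this
  exact congrArg ModuleCat.Hom.hom this

lemma ExtZero.pi {i : ℕ} (r : ℕ) (h : ExtZero R M N i) : ExtZero R M (Fin r → N) i := by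
  induction r with
  | zero =>
    rw [ExtZero.iff_zero]
    intro x
    have hz : (𝟙 (ModuleCat.of R (Fin 0 → N))) = 0 :=
      (ModuleCat.isZero_of_subsingleton _).eq_of_src _ _
    have := Ext.comp_mk₀_id x
    rw [← this, hz, Ext.mk₀_zero, Ext.comp_zero]
  | succ r ih =>
    have e := Fin.consLinearEquiv R (fun _ : Fin (r + 1) => N)
    refine ExtZero.of_equiv_right e ?_
    exact ExtZero.cov_mid (f := LinearMap.inl R N (Fin r → N)) (g := LinearMap.snd R N (Fin r → N))
      Function.Exact.inl_snd LinearMap.inl_injective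
      LinearMap.snd_surjective h ih

/-- If `Ext^a(T, R) = 0` for `a < m` and `pd L < q + 1`, then `Ext^a(T, L) = 0` for
`a + q < m`. -/
lemma ExtZero.of_pdLT_right {T L : Type} [AddCommGroup T] [Module R T] [AddCommGroup L] [Module R L]
    [IsNoetherianRing R] [Module.Finite R L] {m q : ℕ}
    (hT : ∀ a < m, ExtZero R T R a) (hL : PdLT R L (q + 1)) :
    ∀ a, a + q < m → ExtZero R T L a := by
  induction q generalizing L with
  | zero =>
    intro a ha
    have : Module.Projective R L := pdLT_one_iff.1 hL
    obtain ⟨r, f, hf⟩ := Module.Finite.exists_fin' R L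
    obtain ⟨s, hs⟩ := Module.projective_lifting_property f LinearMap.id hf
    have hr := ExtZero.pi r (hT a (by omega))
    rw [ExtZero.iff_zero] at hr ⊢
    intro x
    have h1 := hr (x.comp (Ext.mk₀ (ModuleCat.ofHom s)) (add_zero a))
    have h2 := congrArg (fun w => Ext.comp w (Ext.mk₀ (ModuleCat.ofHom f)) (add_zero a)) h1
    simpa [Ext.comp_assoc_of_third_deg_zero, ← ModuleCat.ofHom_comp, hs] using h2
  | succ q ih =>
    intro a ha
    obtain ⟨r, f, hf⟩ := Module.Finite.exists_fin' R L
    have hex : Function.Exact (LinearMap.ker f).subtype f :=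
      LinearMap.exact_subtype_ker_map f
    have hK : PdLT R (LinearMap.ker f) (q + 1) :=
      pdLT_left hex (Submodule.injective_subtype _) hf
        (pdLT_of_projective (by omega)) hL
    exact ExtZero.cov_right hex (Submodule.injective_subtype _) hf
      (ExtZero.pi r (hT a (by omega))) (ih hK (a + 1) (by omega))

end ExtAlgebra

section FreeResolutions

open CategoryTheory Abelian

variable {R : Type} [CommRing R] {M : Type} [AddCommGroup M] [Module R M]

lemma HasFreeResLE.cons {K τ : Type} [AddCommGroup K] [Module R K] {t : ℕ}
    (hK : HasFreeResLE R K t) (i : K →ₗ[R] (τ →₀ R)) (π : (τ →₀ R) →ₗ[R] M)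
    (hi : Function.Injective i) (hex : Function.Exact i π) (hπ : Function.Surjective π) :
    HasFreeResLE R M (t + 1) := by
  obtain ⟨σ, f, ρ, hρ, h0, hf, he⟩ := hK
  refine ⟨fun j => Nat.casesOn j τ σ, fun j => ?_, π, hπ, ?_, ?_, ?_⟩
  · cases j with
    | zero => exact i ∘ₗ ρ
    | succ j => exact f j
  · intro y
    rw [hex y]
    constructor
    · rintro ⟨x, rfl⟩
      obtain ⟨w, rfl⟩ := hρ x
      exact ⟨w, rfl⟩
    · rintro ⟨w, rfl⟩
      exact ⟨ρ w, rfl⟩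
  · intro j
    cases j with
    | zero =>
      intro y
      have : i (ρ y) = 0 ↔ ρ y = 0 := by
        rw [← map_zero i, hi.eq_iff]
      exact this.trans (h0 y)
    | succ j => exact hf j
  · intro j hj
    cases j with
    | zero => omega
    | succ j => exact he j (by omega)

lemma HasFreeResLE.uncons {t : ℕ} (hM : HasFreeResLE R M (t + 1)) :
    ∃ (τ : Type) (π : (τ →₀ R) →ₗ[R] M), Function.Surjective π ∧
      HasFreeResLE R (LinearMap.ker π) t := by
  obtain ⟨σ, f, π, hπ, h0, hf, he⟩ := hM
  refine ⟨σ 0, π, hπ, fun j => σ (j + 1), fun j => f (j + 1),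
    (f 0).codRestrict _ (fun x => h0.apply_apply_eq_zero x), ?_, ?_, fun j => hf (j + 1), ?_⟩
  · rintro ⟨y, hy⟩
    obtain ⟨x, rfl⟩ := (h0 y).1 hy
    exact ⟨x, rfl⟩
  · intro y
    rw [← hf 0 y]
    exact Subtype.ext_iff
  · exact fun j hj => he (j + 1) (by omega)

lemma HasFreeResLE.pdLT {t : ℕ} (hM : HasFreeResLE R M t) : PdLT R M (t + 1) := by
  induction t generalizing M with
  | zero =>
    obtain ⟨σ, f, π, hπ, h0, hf, he⟩ := hM
    have hinj : Function.Injective π := by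
      rw [injective_iff_map_eq_zero]
      intro x hx
      obtain ⟨y, rfl⟩ := (h0 x).1 hx
      have := he 1 one_pos
      rw [Subsingleton.elim y 0, map_zero]
    exact pdLT_of_equiv (LinearEquiv.ofBijective π ⟨hinj, hπ⟩) (pdLT_of_projective le_rfl)
  | succ t ih =>
    obtain ⟨τ, π, hπ, hK⟩ := hM.uncons
    exact pdLT_right (LinearMap.exact_subtype_ker_map π) (Submodule.injective_subtype _) hπ
      (ih hK) (pdLT_of_projective (by omega))

/-- The Eilenberg swindle: a projective module `K` satisfies `K ⊕ F ≃ F` for some free `F`. -/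
lemma Module.Projective.exists_prod_finsupp_equiv (K : Type) [AddCommGroup K] [Module R K]
    [Module.Projective R K] :
    Nonempty ((K × (ℕ →₀ (K →₀ R))) ≃ₗ[R] (ℕ →₀ (K →₀ R))) := by
  obtain ⟨s, hs⟩ := Module.projective_def'.1 (inferInstance : Module.Projective R K)
  set p : (K →₀ R) →ₗ[R] K := Finsupp.linearCombination R id with hp
  set e : (K →₀ R) →ₗ[R] (K →₀ R) := s ∘ₗ p with he
  have hps : ∀ x, p (s x) = x := fun x => LinearMap.congr_fun hs x
  set up : (ℕ →₀ (K →₀ R)) →ₗ[R] (ℕ →₀ (K →₀ R)) := Finsupp.lmapDomain _ R Nat.succ with hup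
  set dn : (ℕ →₀ (K →₀ R)) →ₗ[R] (ℕ →₀ (K →₀ R)) :=
    Finsupp.lcomapDomain Nat.succ Nat.succ_injective with hdn
  have up0 : ∀ u, up u 0 = 0 := fun u => by
    simp only [hup, Finsupp.lmapDomain_apply]
    exact Finsupp.mapDomain_of_notMem_range _ _ (by simp)
  have upS : ∀ u n, up u (n + 1) = u n := fun u n => by
    simp only [hup, Finsupp.lmapDomain_apply]
    exact Finsupp.mapDomain_apply Nat.succ_injective _ _
  have dnS : ∀ u n, dn u n = u (n + 1) := fun u n => rfl
  let F : (K × (ℕ →₀ (K →₀ R))) →ₗ[R] (ℕ →₀ (K →₀ R)) :=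
    Finsupp.lsingle 0 ∘ₗ s ∘ₗ LinearMap.fst R _ _
      + Finsupp.mapRange.linearMap (LinearMap.id - e) ∘ₗ LinearMap.snd R _ _
      + up ∘ₗ Finsupp.mapRange.linearMap e ∘ₗ LinearMap.snd R _ _
  let G : (ℕ →₀ (K →₀ R)) →ₗ[R] (K × (ℕ →₀ (K →₀ R))) :=
    LinearMap.prod (p ∘ₗ Finsupp.lapply 0)
      (Finsupp.mapRange.linearMap (LinearMap.id - e) + Finsupp.mapRange.linearMap e ∘ₗ dn)
  refine ⟨LinearEquiv.ofLinearMap F G ?_ ?_⟩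
  · refine LinearMap.ext fun v => Finsupp.ext fun n => ?_
    cases n with
    | zero => simp [F, G, up0, dnS, he, hps]
    | succ n => simp [F, G, upS, dnS, he, hps]
  · refine LinearMap.ext fun v => Prod.ext ?_ (Finsupp.ext fun n => ?_)
    · simp [F, G, up0, he, hps]
    · cases n with
      | zero => simp [F, G, up0, upS, dnS, he, hps]
      | succ n => simp [F, G, upS, dnS, he, hps]

lemma hasFreeResLE_zero_of_equiv {τ : Type} (e : (τ →₀ R) ≃ₗ[R] M) : HasFreeResLE R M 0 := by
  refine ⟨fun j => Nat.casesOn j τ (fun _ => Empty), fun j => 0, e.toLinearMap, e.surjective,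
    ?_, ?_, ?_⟩
  · intro y
    simp
    exact ⟨fun h => h ▸ rfl, fun h => h ▸ rfl⟩
  · intro j y
    have : IsEmpty (Nat.casesOn (j + 1) τ (fun _ => Empty) : Type) :=
      inferInstanceAs (IsEmpty Empty)
    exact ⟨fun h => ⟨0, (Subsingleton.elim _ _)⟩, fun _ => rfl⟩
  · intro j hj
    cases j with
    | zero => omega
    | succ j => exact inferInstanceAs (IsEmpty Empty)

lemma hasFreeResLE_of_pdLT {t : ℕ} (h : PdLT R M (t + 2)) : HasFreeResLE R M (t + 1) := by
  have hπ := Finsupp.linearCombination_id_surjective R M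
  set π : (M →₀ R) →ₗ[R] M := Finsupp.linearCombination R id
  have hK : PdLT R (LinearMap.ker π) (t + 1) :=
    pdLT_left (LinearMap.exact_subtype_ker_map π) (Submodule.injective_subtype _) hπ
      (pdLT_of_projective (by omega)) h
  induction t generalizing M with
  | zero =>
    have : Module.Projective R (LinearMap.ker π) := pdLT_one_iff.1 hK
    obtain ⟨e⟩ := Module.Projective.exists_prod_finsupp_equiv (R := R) (LinearMap.ker π)
    set K := LinearMap.ker π
    let b : (ℕ →₀ (K →₀ R)) ≃ₗ[R] (ℕ × K →₀ R) := (Finsupp.curryLinearEquiv R).symm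
    let i : (ℕ × K →₀ R) →ₗ[R] (M ⊕ (ℕ × K) →₀ R) :=
      (Finsupp.sumFinsuppLEquivProdFinsupp R).symm.toLinearMap ∘ₗ
        (LinearMap.prodMap K.subtype b.toLinearMap) ∘ₗ (e.symm.toLinearMap) ∘ₗ b.symm.toLinearMap
    let ρ : (M ⊕ (ℕ × K) →₀ R) →ₗ[R] M := π ∘ₗ LinearMap.fst R _ _ ∘ₗ
      (Finsupp.sumFinsuppLEquivProdFinsupp R).toLinearMap
    refine (hasFreeResLE_zero_of_equiv (LinearEquiv.refl R (ℕ × K →₀ R))).cons i ρ ?_ ?_ ?_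
    · simp only [i, LinearMap.coe_comp, LinearEquiv.coe_coe]
      refine (LinearEquiv.injective _).comp (Function.Injective.comp ?_
        ((LinearEquiv.injective _).comp (LinearEquiv.injective _)))
      exact Function.Injective.prodMap (Submodule.injective_subtype _) b.injective
    · intro y
      constructor
      · intro hy
        have hy' : π ((Finsupp.sumFinsuppLEquivProdFinsupp R y).1) = 0 := hy
        refine ⟨b (e (⟨_, hy'⟩, b.symm (Finsupp.sumFinsuppLEquivProdFinsupp R y).2)), ?_⟩
        simp only [i, LinearMap.coe_comp, LinearEquiv.coe_coe, Function.comp_apply,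
          LinearEquiv.symm_apply_apply]
        rw [LinearEquiv.symm_apply_eq]
        simp
      · rintro ⟨x, rfl⟩
        simp only [i, ρ, LinearMap.coe_comp, LinearEquiv.coe_coe, Function.comp_apply,
          LinearEquiv.apply_symm_apply]
        exact (e.symm (b.symm x)).1.2
    · simp only [ρ, LinearMap.coe_comp, LinearEquiv.coe_coe]
      exact hπ.comp (LinearMap.fst_surjective.comp (LinearEquiv.surjective _))
  | succ t ih =>
    have hπ' := Finsupp.linearCombination_id_surjective R (LinearMap.ker π)
    refine (ih hK hπ' ?_).cons (LinearMap.ker π).subtype π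
      (Submodule.injective_subtype _) (LinearMap.exact_subtype_ker_map π) hπ
    exact pdLT_left (LinearMap.exact_subtype_ker_map _) (Submodule.injective_subtype _) hπ'
      (pdLT_of_projective (by omega)) hK

/-- A nonzero finite module with `Ext^i(M, R) = 0` for `i < d` has projective dimension at
least `d`. -/
lemma subsingleton_of_pdLT_of_extZero [IsNoetherianRing R] [Module.Finite R M] {d : ℕ}
    (hE : ∀ i < d, ExtZero R M R i) (hpd : PdLT R M d) : Subsingleton M := by
  induction d with
  | zero => exact pdLT_zero_iff.1 hpd
  | succ d ih =>
    refine ih (fun i hi => hE i (by omega)) ?_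
    refine ModuleCat.hasProjectiveDimensionLT_of_forall_finite _ _ fun L _ => ?_
    obtain ⟨r, f, hf⟩ := Module.Finite.exists_fin' R L
    exact ExtZero.cov_right (LinearMap.exact_subtype_ker_map f)
      (Submodule.injective_subtype _) hf (ExtZero.pi r (hE d (by omega)))
      (ExtZero.of_pdLT hpd le_rfl)

end FreeResolutions

section ExtDual

open CategoryTheory Abelian

variable {R : Type} [CommRing R]

/-- If `X` is finite with `pd X ≤ t`, `pd X^* < s` and `Ext^i(X, R) = 0` for `1 ≤ i < t`, then
`pd Ext^t(X, R) ≤ s + t`. -/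
lemma pdLT_ext [IsNoetherianRing R] {X : Type} [AddCommGroup X] [Module R X] [Module.Finite R X]
    {s t : ℕ} (hD : PdLT R (X →ₗ[R] R) s) (hX : PdLT R X (t + 2))
    (hE : ∀ i, 1 ≤ i → i < t + 1 → ExtZero R X R i) :
    PdLT R (Ext (ModuleCat.of R X) (ModuleCat.of R R) (t + 1)) (s + t + 2) := by
  induction t generalizing X s
  case' succ => rename_i t ih _ _ _
  all_goals
    obtain ⟨r, π, hπ⟩ := Module.Finite.exists_fin' R X
    have hex : Function.Exact (LinearMap.ker π).subtype π := LinearMap.exact_subtype_ker_map π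
    have hinj := Submodule.injective_subtype (LinearMap.ker π)
    have hK := pdLT_left hex hinj hπ (pdLT_of_projective (by omega)) hX
    have hses := linShort_shortExact hex hinj hπ
    set S := linShort _ _ hex with hS
    set K := LinearMap.ker π with hKdef
    -- the restriction map of dual modules
    let res : ((Fin r → R) →ₗ[R] R) →ₗ[R] (K →ₗ[R] R) := LinearMap.lcomp R R K.subtype
    have hexD : Function.Exact (LinearMap.lcomp R R π) res := by
      intro h
      constructor
      · intro hh
        have hle : LinearMap.ker π ≤ LinearMap.ker h := fun x hx => LinearMap.congr_fun hh ⟨x, hx⟩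
        refine ⟨(LinearMap.ker π).liftQ h hle ∘ₗ (π.quotKerEquivOfSurjective hπ).symm, ?_⟩
        ext x
        simp only [LinearMap.lcomp_apply, LinearMap.coe_comp, LinearEquiv.coe_coe,
          Function.comp_apply]
        have : (π.quotKerEquivOfSurjective hπ).symm (π (LinearMap.single R (fun _ => R) x 1)) =
            Submodule.Quotient.mk (LinearMap.single R (fun _ => R) x 1) := by
          rw [LinearEquiv.symm_apply_eq]; rfl
        rw [this]; simp
      · rintro ⟨g, rfl⟩
        ext x
        have : π x.1 = 0 := x.2
        simp [res, this]
    have hinjD : Function.Injective (LinearMap.lcomp R R π : (X →ₗ[R] R) →ₗ[R] _) := by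
      intro a b hab
      ext x
      obtain ⟨y, rfl⟩ := hπ x
      exact LinearMap.congr_fun hab y
    have hI : PdLT R (LinearMap.range res) (s + 1) := by
      refine pdLT_right (f := LinearMap.lcomp R R π) (g := res.rangeRestrict) ?_ hinjD
        res.surjective_rangeRestrict hD (pdLT_of_projective (by omega))
      intro y
      rw [← hexD y]
      exact Subtype.ext_iff
  case zero =>
    have : Module.Projective R K := pdLT_one_iff.1 hK
    let lin : (K →ₗ[R] R) →ₗ[R] (ModuleCat.of R K ⟶ ModuleCat.of R R) :=
      { toFun := ModuleCat.ofHom, map_add' := fun _ _ => rfl, map_smul' := fun _ _ => rfl }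
    let δ : (K →ₗ[R] R) →ₗ[R] Ext (ModuleCat.of R X) (ModuleCat.of R R) 1 :=
      (Ext.bilinearCompOfLinear R _ _ _ 1 0 1 rfl hses.extClass) ∘ₗ
        (Ext.linearEquiv₀ (R := R)).symm.toLinearMap ∘ₗ lin
    have hδ : ∀ h : K →ₗ[R] R, δ h = hses.extClass.comp (Ext.mk₀ (ModuleCat.ofHom h)) rfl :=
      fun h => rfl
    refine pdLT_right (f := (LinearMap.range res).subtype) (g := δ) ?_
      (Submodule.injective_subtype _) ?_ hI (pdLT_of_projective (by omega))
    · intro h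
      rw [hδ]
      constructor
      · intro hh
        obtain ⟨x, hx⟩ := Ext.contravariant_sequence_exact₁ hses _ _ _ hh
        obtain ⟨y, rfl⟩ := (Ext.mk₀_bijective _ _).2 x
        rw [Ext.mk₀_comp_mk₀, (Ext.mk₀_bijective _ _).1.eq_iff] at hx
        refine ⟨⟨h, ⟨y.hom, ?_⟩⟩, rfl⟩
        exact congrArg ModuleCat.Hom.hom hx
      · rintro ⟨⟨h, ⟨g, rfl⟩⟩, rfl⟩
        have : (ModuleCat.ofHom (res g)) = S.f ≫ ModuleCat.ofHom g := rfl
        simp only [Submodule.subtype_apply]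
        rw [this, ← Ext.mk₀_comp_mk₀, ← Ext.comp_assoc _ _ _ (by rfl) (by rfl) (by rfl),
          hses.extClass_comp, Ext.zero_comp]
    · intro x
      have hz : ExtZero R (Fin r → R) R 1 := ExtZero.of_pdLT (pdLT_of_projective le_rfl) le_rfl
      obtain ⟨y, rfl⟩ := Ext.contravariant_sequence_exact₃ hses _ x (hz.elim _ _) (add_zero 1)
      obtain ⟨h, rfl⟩ := (Ext.mk₀_bijective _ _).2 y
      exact ⟨h.hom, rfl⟩
  case succ =>
    have hz : ∀ i, ExtZero R (Fin r → R) R (i + 1) :=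
      fun i => ExtZero.of_pdLT (pdLT_of_projective le_rfl) (by omega)
    have hres : Function.Surjective res := by
      intro h
      obtain ⟨x, hx⟩ := Ext.contravariant_sequence_exact₁ hses (ModuleCat.of R R)
        (Ext.mk₀ (ModuleCat.ofHom h)) (add_zero 1) ((hE 1 le_rfl (by omega)).elim _ _)
      obtain ⟨y, rfl⟩ := (Ext.mk₀_bijective _ _).2 x
      rw [Ext.mk₀_comp_mk₀, (Ext.mk₀_bijective _ _).1.eq_iff] at hx
      exact ⟨y.hom, congrArg ModuleCat.Hom.hom hx⟩
    have hKD : PdLT R (K →ₗ[R] R) (s + 1) :=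
      pdLT_right hexD hinjD hres hD (pdLT_of_projective (by omega))
    have hKE : ∀ i, 1 ≤ i → i < t + 1 → ExtZero R K R i := fun i h1 h2 =>
      ExtZero.contra_left hex hinj hπ
        (by obtain ⟨i, rfl⟩ := Nat.exists_eq_add_of_le' h1; exact hz i)
        (hE (i + 1) (by omega) (by omega))
    let δ : Ext (ModuleCat.of R K) (ModuleCat.of R R) (t + 1) →ₗ[R]
        Ext (ModuleCat.of R X) (ModuleCat.of R R) (t + 1 + 1) :=
      Ext.precompOfLinear hses.extClass R _ (add_comm 1 (t + 1))
    have hδ : ∀ x, δ x = hses.extClass.comp x (add_comm 1 (t + 1)) := fun x => rfl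
    have hδb : Function.Bijective δ := by
      constructor
      · rw [injective_iff_map_eq_zero]
        intro x hx
        obtain ⟨y, rfl⟩ := Ext.contravariant_sequence_exact₁ hses _ x (add_comm 1 (t + 1)) hx
        rw [(hz t).elim y 0, Ext.comp_zero]
      · intro x
        obtain ⟨y, rfl⟩ := Ext.contravariant_sequence_exact₃ hses _ x ((hz (t + 1)).elim _ _)
          (add_comm 1 (t + 1))
        exact ⟨y, rfl⟩
    have := pdLT_of_equiv (LinearEquiv.ofBijective δ hδb) (ih hKD hK hKE)
    rwa [show s + 1 + t + 2 = s + (t + 1) + 2 by omega] at this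

end ExtDual

section RegularLocal

open scoped Pointwise
open IsLocalRing RingTheory.Sequence

lemma ringKrullDim_le_length_of_ofList_eq {A : Type} [CommRing A] [IsLocalRing A]
    [IsNoetherianRing A] {l : List A} (hl : Ideal.ofList l = maximalIdeal A) :
    ringKrullDim A ≤ l.length := by
  classical
  refine (ringKrullDim_le_spanFinrank_maximalIdeal A).trans ?_
  rw [← hl]
  have h1 : Submodule.spanFinrank (Ideal.ofList l) ≤ ({r | r ∈ l} : Set A).ncard :=
    Submodule.spanFinrank_span_le_ncard_of_finite l.finite_toSet
  have h2 : ({r | r ∈ l} : Set A).ncard ≤ l.length := by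
    have : ({r | r ∈ l} : Set A) = (l.toFinset : Set A) := by ext; simp
    rw [this, Set.ncard_coe_finset]
    exact l.toFinset_card_le
  exact_mod_cast h1.trans h2

lemma exists_isPrime_le_ringKrullDim_quotient {A : Type} [CommRing A] {h : ℕ}
    (hd : (h : WithBot ℕ∞) ≤ ringKrullDim A) :
    ∃ q : Ideal A, q.IsPrime ∧ (h : WithBot ℕ∞) ≤ ringKrullDim (A ⧸ q) := by
  obtain ⟨l, hl⟩ := Order.le_krullDim_iff.1 hd
  refine ⟨l.head.asIdeal, l.head.isPrime, ?_⟩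
  rw [ringKrullDim_quotient]
  refine Order.le_krullDim_iff.2 ⟨⟨l.length, fun i => ⟨l i, ?_⟩, fun i => l.step i⟩, hl⟩
  have : l.head ≤ l i := LTSeries.head_le l i
  exact this

/-- A noetherian local ring whose maximal ideal is generated by at most `dim A` elements is a
domain, and the generators form a regular sequence. -/
lemma isDomain_and_isWeaklyRegular_of_ofList_eq {A : Type} [CommRing A] [IsLocalRing A]
    [IsNoetherianRing A] (l : List A) (hl : Ideal.ofList l = maximalIdeal A)
    (hd : (l.length : WithBot ℕ∞) ≤ ringKrullDim A) : IsDomain A ∧ IsWeaklyRegular A l := by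
  generalize hlen : l.length = h at hd
  induction h generalizing A with
  | zero =>
    obtain rfl := List.length_eq_zero_iff.1 hlen
    rw [Ideal.ofList_nil] at hl
    exact ⟨(isField_iff_maximalIdeal_eq.2 hl.symm).isDomain, IsWeaklyRegular.nil _ _⟩
  | succ h ih =>
    obtain ⟨x, l, rfl⟩ := List.exists_cons_of_length_eq_add_one hlen
    have hxm : x ∈ maximalIdeal A := by
      rw [← hl, Ideal.ofList_cons]
      exact Ideal.mem_sup_left (Ideal.mem_span_singleton_self x)
    have hx1 : Ideal.span {x} ≠ ⊤ := fun h =>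
      (maximalIdeal.isMaximal A).ne_top (top_le_iff.1 (h ▸ (Ideal.span_singleton_le_iff_mem _).2 hxm))
    have := Ideal.Quotient.nontrivial_iff.2 hx1
    have : IsLocalRing (A ⧸ Ideal.span {x}) :=
      IsLocalRing.of_surjective' _ (Ideal.Quotient.mk_surjective (I := Ideal.span {x}))
    have hmap : Ideal.ofList (l.map (Ideal.Quotient.mk (Ideal.span {x}))) =
        maximalIdeal (A ⧸ Ideal.span {x}) := by
      have h1 : (maximalIdeal A).map (Ideal.Quotient.mk (Ideal.span {x})) = maximalIdeal _ :=
        IsLocalRing.map_maximalIdeal_of_surjective _ Ideal.Quotient.mk_surjective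
      rw [← h1, ← hl, Ideal.ofList_cons, Ideal.map_sup, Ideal.map_quotient_self, bot_sup_eq,
        Ideal.map_ofList]
    have quotdim : ∀ (B : Type) [CommRing B] [IsNoetherianRing B] [IsLocalRing B] (y : B),
        y ∈ maximalIdeal B → ((h + 1 : ℕ) : WithBot ℕ∞) ≤ ringKrullDim B →
        (h : WithBot ℕ∞) ≤ ringKrullDim (B ⧸ Ideal.span {y}) := by
      intro B _ _ _ y hy hB
      have h1 := ringKrullDim_le_ringKrullDim_quotSMulTop_succ hy
      have h2 : y • (⊤ : Ideal B) = Ideal.span {y} := by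
        simp [← Submodule.ideal_span_singleton_smul]
      rw [h2] at h1
      have h3 := hB.trans h1
      rw [Nat.cast_add, Nat.cast_one] at h3
      exact (ENat.WithBot.add_le_add_natCast_right_iff (c := 1)).1 (by exact_mod_cast h3)
    obtain ⟨hdom, hreg⟩ := ih (A := A ⧸ Ideal.span {x}) (l.map (Ideal.Quotient.mk _)) hmap
      (by simpa using hlen) (quotdim A x hxm hd)
    have hle : ringKrullDim (A ⧸ Ideal.span {x}) ≤ (h : WithBot ℕ∞) := by
      have := ringKrullDim_le_length_of_ofList_eq hmap
      simpa [show l.length = h by simpa using hlen] using this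
    obtain ⟨q, hq, hqd⟩ := exists_isPrime_le_ringKrullDim_quotient hd
    have hxq : x ∉ q := fun hx => by
      have h1 := ringKrullDim_le_of_surjective
        (Ideal.Quotient.factor ((Ideal.span_singleton_le_iff_mem q).2 hx))
        (Ideal.Quotient.factor_surjective _)
      have h2 := hqd.trans (h1.trans hle)
      have h3 : h + 1 ≤ h := by exact_mod_cast h2
      omega
    have : IsLocalRing (A ⧸ q) :=
      IsLocalRing.of_surjective' _ (Ideal.Quotient.mk_surjective (I := q))
    have hB := quotdim (A ⧸ q) (Ideal.Quotient.mk q x) (by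
      rw [← IsLocalRing.map_maximalIdeal_of_surjective _ (Ideal.Quotient.mk_surjective (I := q))]
      exact Ideal.mem_map_of_mem _ hxm) hqd
    have hqx : q ≤ Ideal.span {x} := by
      intro r hr
      by_contra hrx
      set g : A →+* (A ⧸ q) ⧸ Ideal.span {Ideal.Quotient.mk q x} :=
        (Ideal.Quotient.mk _).comp (Ideal.Quotient.mk q) with hg
      have hgx : ∀ a ∈ Ideal.span {x}, g a = 0 := by
        intro a ha
        obtain ⟨b, rfl⟩ := Ideal.mem_span_singleton'.1 ha
        rw [hg, RingHom.comp_apply, Ideal.Quotient.eq_zero_iff_mem, map_mul]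
        exact Ideal.mul_mem_left _ _ (Ideal.mem_span_singleton_self _)
      have hgs : Function.Surjective g :=
        Ideal.Quotient.mk_surjective.comp Ideal.Quotient.mk_surjective
      have h1 := ringKrullDim_succ_le_of_surjective (Ideal.Quotient.lift _ g hgx)
        (Ideal.Quotient.lift_surjective_of_surjective _ _ hgs)
        (r := Ideal.Quotient.mk _ r)
        (mem_nonZeroDivisors_of_ne_zero (by rwa [Ne, Ideal.Quotient.eq_zero_iff_mem]))
        (by rw [Ideal.Quotient.lift_mk, hg, RingHom.comp_apply, Ideal.Quotient.eq_zero_iff_mem.2 hr,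
          map_zero])
      have h2 := (add_le_add_left hB 1).trans (h1.trans hle)
      have h3 : h + 1 ≤ h := by exact_mod_cast h2
      omega
    have hbot : q = ⊥ := by
      refine Submodule.eq_bot_of_le_smul_of_le_jacobson_bot (Ideal.span {x}) q
        (IsNoetherian.noetherian q) ?_ ?_
      · intro r hr
        obtain ⟨b, rfl⟩ := Ideal.mem_span_singleton'.1 (hqx hr)
        have hb : b ∈ q := (hq.mem_or_mem hr).resolve_right hxq
        rw [mul_comm]
        exact Submodule.smul_mem_smul (Ideal.mem_span_singleton_self x) hb
      · rw [IsLocalRing.jacobson_eq_maximalIdeal _ bot_ne_top]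
        exact (Ideal.span_singleton_le_iff_mem _).2 hxm
    subst hbot
    have : IsDomain A := IsDomain.of_bot_isPrime A
    refine ⟨this, (isWeaklyRegular_cons_iff' _ _ _).2 ⟨?_, ?_⟩⟩
    · exact IsSMulRegular.of_ne_zero (by simpa using hxq)
    · let e : QuotSMulTop x A ≃ₗ[A ⧸ Ideal.span {x}] (A ⧸ Ideal.span {x}) :=
        { Submodule.quotEquivOfEq (x • (⊤ : Ideal A)) (Ideal.span {x})
            (by simp [← Submodule.ideal_span_singleton_smul]) with
          map_smul' := by
            intro a b
            obtain ⟨a, rfl⟩ := Ideal.Quotient.mk_surjective a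
            obtain ⟨b, rfl⟩ := Submodule.Quotient.mk_surjective _ b
            rfl }
      exact (e.isWeaklyRegular_congr _).2 hreg

end RegularLocal

section Grade

open scoped Pointwise
open CategoryTheory Abelian IsLocalRing RingTheory.Sequence

lemma ExtZero.quotient_of_isWeaklyRegular {R : Type} [CommRing R] {T N : Type} [AddCommGroup T]
    [Module R T] [AddCommGroup N] [Module R N] {h : ℕ} (rs : List R) (hrs : IsWeaklyRegular N rs)
    (hT : ∀ i < h, ExtZero R T N i) :
    ∀ i, i + rs.length < h → ExtZero R T (N ⧸ (Ideal.ofList rs • ⊤ : Submodule R N)) i := by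
  induction rs generalizing N h with
  | nil =>
    intro i hi
    refine ExtZero.of_equiv_right (Submodule.quotEquivOfEqBot _ (by simp)).symm (hT i ?_)
    simpa using hi
  | cons x rs ih =>
    intro i hi
    rw [isWeaklyRegular_cons_iff] at hrs
    have hex : Function.Exact (LinearMap.lsmul R N x) (x • (⊤ : Submodule R N)).mkQ := by
      intro y
      rw [Submodule.mkQ_apply, Submodule.Quotient.mk_eq_zero,
        Submodule.mem_smul_pointwise_iff_exists]
      simp
    refine ExtZero.of_equiv_right
      (Submodule.quotOfListConsSMulTopEquivQuotSMulTopInner N x rs).symm ?_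
    refine ih hrs.2 (h := h - 1) (fun j hj => ?_) i (by simp at hi; omega)
    exact ExtZero.cov_right hex hrs.1 (Submodule.mkQ_surjective _) (hT j (by omega))
      (hT (j + 1) (by omega))

/-- A regular local ring has depth at least its dimension. -/
lemma ExtZero.residueField_of_isRegularLocalRing {A : Type} [CommRing A] [IsRegularLocalRing A]
    {h : ℕ} (hd : (h : WithBot ℕ∞) ≤ ringKrullDim A) :
    ∀ i < h, ExtZero A (A ⧸ maximalIdeal A) A i := by
  obtain ⟨s, hs, hspan⟩ :=
    Submodule.FG.exists_span_finset_card_eq_spanFinrank (IsNoetherian.noetherian (maximalIdeal A))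
  have hl : Ideal.ofList s.toList = maximalIdeal A := by
    rw [← hspan, Ideal.ofList]
    simp [Ideal.span]
  have hlen : (s.toList.length : WithBot ℕ∞) = ringKrullDim A := by
    rw [← IsRegularLocalRing.spanFinrank_maximalIdeal, Finset.length_toList, hs]
  have hmem : ∀ r ∈ s.toList, r ∈ maximalIdeal A := fun r hr => hl ▸ Ideal.subset_span hr
  have hne : maximalIdeal A • (⊤ : Submodule A A) < ⊤ := by
    rw [smul_eq_mul, Ideal.mul_top]
    exact lt_top_iff_ne_top.2 (Ideal.IsPrime.ne_top')
  have hw := (isDomain_and_isWeaklyRegular_of_ofList_eq s.toList hl hlen.le).2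
  have hreg : IsRegular A s.toList := ⟨hw, by rw [hl]; exact hne.ne'⟩
  intro i hi
  refine ModuleCat.subsingleton_ext_of_exists_isRegular (maximalIdeal A)
    (ModuleCat.of A (A ⧸ maximalIdeal A)) ?_ (ModuleCat.of A A) hne s.toList hmem hreg i ?_
  · rw [Module.support_eq_zeroLocus, Ideal.annihilator_quotient]
  · have : (h : WithBot ℕ∞) ≤ (s.toList.length : WithBot ℕ∞) := hlen ▸ hd
    exact hi.trans_le (by exact_mod_cast this)

lemma exists_isSMulRegular_quotient {R : Type} [CommRing R] [IsRegularRing R] {J : Ideal R}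
    (rs : List R) (hrs : IsWeaklyRegular R rs)
    (hJ : ∀ P : Ideal R, P.IsPrime → J ≤ P → (rs.length + 1 : ℕ∞) ≤ P.height) :
    ∃ x ∈ J, IsSMulRegular (R ⧸ (Ideal.ofList rs • ⊤ : Submodule R R)) x := by
  by_contra hcon
  push Not at hcon
  set N := R ⧸ (Ideal.ofList rs • ⊤ : Submodule R R)
  have hsub : (J : Set R) ⊆ ⋃ p ∈ associatedPrimes R N, (p : Set R) := by
    rw [biUnion_associatedPrimes_eq_compl_regular R]
    exact fun x hx => hcon x hx
  obtain ⟨P, hP, hJP⟩ := (Ideal.subset_union_prime_finite (associatedPrimes.finite R N) ⊤ ⊤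
    fun I hin _ _ => IsAssociatedPrime.isPrime hin).1 hsub
  have hPp : P.IsPrime := hP.isPrime
  have ht := hJ P hPp hJP
  obtain ⟨n, hn⟩ := (isAssociatedPrime_iff.1 hP).2
  obtain ⟨n, rfl⟩ := Submodule.Quotient.mk_surjective _ n
  have hmemP : ∀ r : R, r ∈ P ↔ r * n ∈ Ideal.ofList rs := by
    intro r
    rw [hn, Submodule.mem_colon_singleton, Submodule.mem_bot, ← Submodule.Quotient.mk_smul,
      Submodule.Quotient.mk_eq_zero, smul_eq_mul, smul_eq_mul, Ideal.mul_top]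
  let A := Localization.AtPrime P
  let rs' := rs.map (algebraMap R A)
  have hofl : (Ideal.ofList rs' • ⊤ : Submodule A A) = (Ideal.ofList rs).map (algebraMap R A) := by
    rw [smul_eq_mul, Ideal.mul_top, Ideal.map_ofList]
  have hrs' : IsWeaklyRegular A rs' := hrs.of_isLocalization A P.primeCompl
  have hdim : ((rs.length + 1 : ℕ) : WithBot ℕ∞) ≤ ringKrullDim A := by
    rw [IsLocalization.AtPrime.ringKrullDim_eq_height P A]
    exact_mod_cast ht
  have hz := ExtZero.quotient_of_isWeaklyRegular rs' hrs'
    (ExtZero.residueField_of_isRegularLocalRing hdim) 0 (by simp [rs'])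
  let a : A ⧸ (Ideal.ofList rs' • ⊤ : Submodule A A) := Submodule.Quotient.mk (algebraMap R A n)
  have hle : maximalIdeal A ≤ LinearMap.ker (LinearMap.toSpanSingleton A _ a) := by
    rw [← IsLocalization.AtPrime.map_eq_maximalIdeal P A, Ideal.map_le_iff_le_comap]
    intro r hr
    rw [Ideal.mem_comap, LinearMap.mem_ker, LinearMap.toSpanSingleton_apply,
      ← Submodule.Quotient.mk_smul, Submodule.Quotient.mk_eq_zero, hofl, smul_eq_mul, ← map_mul]
    exact Ideal.mem_map_of_mem _ ((hmemP r).1 hr)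
  have h0 := DFunLike.congr_fun (hz.linearMap_eq_zero ((maximalIdeal A).liftQ _ hle))
    (Submodule.Quotient.mk 1)
  rw [Submodule.liftQ_apply, LinearMap.toSpanSingleton_apply, one_smul, LinearMap.zero_apply,
    Submodule.Quotient.mk_eq_zero, hofl,
    IsLocalization.algebraMap_mem_map_algebraMap_iff P.primeCompl] at h0
  obtain ⟨s, hs, hsn⟩ := h0
  exact hs ((hmemP s).2 hsn)

/-- In a regular ring every ideal of height at least `m` has grade at least `m`. -/
lemma exists_isWeaklyRegular_of_le_height {R : Type} [CommRing R] [IsRegularRing R] {J : Ideal R}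
    {m : ℕ} (hJ : ∀ P : Ideal R, P.IsPrime → J ≤ P → (m : ℕ∞) ≤ P.height) :
    ∃ rs : List R, rs.length = m ∧ (∀ r ∈ rs, r ∈ J) ∧ IsWeaklyRegular R rs := by
  suffices ∀ r ≤ m, ∃ rs : List R, rs.length = r ∧ (∀ r ∈ rs, r ∈ J) ∧ IsWeaklyRegular R rs from
    this m le_rfl
  intro r
  induction r with
  | zero => exact fun _ => ⟨[], rfl, by simp, IsWeaklyRegular.nil _ _⟩
  | succ r ih =>
    intro hr
    obtain ⟨rs, hlen, hmem, hreg⟩ := ih (by omega)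
    obtain ⟨x, hxJ, hx⟩ := exists_isSMulRegular_quotient (J := J) rs hreg fun P hP hJP => by
      refine le_trans ?_ (hJ P hP hJP)
      rw [hlen]
      exact_mod_cast hr
    refine ⟨rs ++ [x], by simp [hlen], ?_, ?_⟩
    · intro y hy
      rcases List.mem_append.1 hy with h | h
      · exact hmem y h
      · rw [List.mem_singleton.1 h]
        exact hxJ
    · rw [isWeaklyRegular_append_iff]
      refine ⟨hreg, (isWeaklyRegular_cons_iff _ _ _).2 ⟨hx, IsWeaklyRegular.nil _ _⟩⟩

/-- Rees' theorem for an ideal of height at least `m` in a regular ring. -/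
lemma ExtZero.of_le_height {R : Type} [CommRing R] [IsRegularRing R] {J : Ideal R}
    {m : ℕ} (hJ : ∀ P : Ideal R, P.IsPrime → J ≤ P → (m : ℕ∞) ≤ P.height) (hJt : J ≠ ⊤)
    {T : Type} [AddCommGroup T] [Module R T] [Module.Finite R T]
    (hT : Module.support R T ⊆ PrimeSpectrum.zeroLocus J) : ∀ i < m, ExtZero R T R i := by
  obtain ⟨rs, hlen, hmem, hreg⟩ := exists_isWeaklyRegular_of_le_height hJ
  have hle : Ideal.ofList rs ≤ J := Ideal.span_le.2 hmem
  intro i hi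
  refine ModuleCat.subsingleton_ext_of_exists_isRegular J (ModuleCat.of R T) hT
    (ModuleCat.of R R) ?_ rs hmem ⟨hreg, ?_⟩ i (by omega)
  · rw [smul_eq_mul, Ideal.mul_top]
    exact lt_top_iff_ne_top.2 hJt
  · rw [smul_eq_mul, Ideal.mul_top]
    exact fun h => hJt (top_le_iff.1 (h ▸ hle))

end Grade

section DegreeFiltration


variable {k σ : Type} [Field k]

/-- The ideal of polynomials all of whose monomials have `w`-degree at least `e`. -/
def degGE (w : σ → ℕ) (e : ℕ) : Ideal (MvPolynomial σ k) where
  carrier := {f | ∀ d, Finsupp.weight w d < e → coeff d f = 0}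
  zero_mem' := fun _ _ => coeff_zero _
  add_mem' := fun hf hg d hd => by rw [coeff_add, hf d hd, hg d hd, add_zero]
  smul_mem' := fun c f hf _ hd => by
    classical
    rw [smul_eq_mul, coeff_mul]
    refine Finset.sum_eq_zero fun x hx => ?_
    rw [hf x.2, mul_zero]
    refine lt_of_le_of_lt ?_ hd
    rw [← Finset.HasAntidiagonal.mem_antidiagonal.1 hx, map_add]
    exact Nat.le_add_left _ _

lemma degGE_zero (w : σ → ℕ) : degGE w 0 = (⊤ : Ideal (MvPolynomial σ k)) :=
  top_le_iff.1 fun _ _ _ hd => absurd hd (Nat.not_lt_zero _)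

lemma degGE_anti (w : σ → ℕ) {a b : ℕ} (h : a ≤ b) :
    (degGE w b : Ideal (MvPolynomial σ k)) ≤ degGE w a :=
  fun _ hf d hd => hf d (hd.trans_le h)

lemma mul_mem_degGE {w : σ → ℕ} {a b : ℕ} {f g : MvPolynomial σ k} (hf : f ∈ degGE w a)
    (hg : g ∈ degGE w b) : f * g ∈ degGE w (a + b) := by
  classical
  intro d hd
  rw [coeff_mul]
  refine Finset.sum_eq_zero fun x hx => ?_
  rw [← Finset.HasAntidiagonal.mem_antidiagonal.1 hx, map_add] at hd
  by_cases h : Finsupp.weight w x.1 < a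
  · rw [hf _ h, zero_mul]
  · rw [hg x.2 (by omega), mul_zero]

lemma MvPolynomial.IsWeightedHomogeneous.mem_degGE {w : σ → ℕ} {e : ℕ} {f : MvPolynomial σ k}
    (hf : IsWeightedHomogeneous w f e) : f ∈ degGE w e := by
  intro d hd
  by_contra h
  exact hd.ne (hf h)

lemma X_mul_mem_degGE_iff {w : σ → ℕ} {i : σ} (hi : w i = 1) {e : ℕ} {f : MvPolynomial σ k} :
    X i * f ∈ degGE w (e + 1) ↔ f ∈ degGE w e := by
  classical
  constructor
  · intro h d hd
    have := h (d + Finsupp.single i 1) (by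
      rw [map_add, Finsupp.weight_single]
      simpa [hi] using hd)
    rwa [add_comm d, coeff_X_mul] at this
  · intro h
    rw [add_comm]
    refine mul_mem_degGE (IsWeightedHomogeneous.mem_degGE ?_) h
    rw [← hi]
    exact isWeightedHomogeneous_X k w i

lemma weightedHomogeneousComponent_mul_of_isWeightedHomogeneous {w : σ → ℕ} {c : ℕ}
    {a : MvPolynomial σ k} (ha : IsWeightedHomogeneous w a c) (j : ℕ) (f : MvPolynomial σ k) :
    weightedHomogeneousComponent w (c + j) (a * f) = a * weightedHomogeneousComponent w j f := by
  classical
  let := weightedGradedAlgebra k w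
  have := DirectSum.coe_decompose_mul_add_of_left_mem (weightedHomogeneousSubmodule k w) (i := c)
    (j := j) (a := a) (b := f) ((mem_weightedHomogeneousSubmodule k w c a).2 ha)
  exact (weightedDecomposition.decompose'_apply k w (a * f) (c + j)).symm.trans
    (this.trans (congrArg (a * ·) (weightedDecomposition.decompose'_apply k w f j)))

/-- The part of `f` of `w`-degree at least `e`. -/
noncomputable def truncGE (w : σ → ℕ) (e : ℕ) : MvPolynomial σ k →ₗ[k] MvPolynomial σ k :=
  LinearMap.id - ∑ i ∈ Finset.range e, weightedHomogeneousComponent w i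

lemma truncGE_apply (w : σ → ℕ) (e : ℕ) (f : MvPolynomial σ k) :
    truncGE w e f = f - ∑ i ∈ Finset.range e, weightedHomogeneousComponent w i f := by
  simp [truncGE]

lemma coeff_truncGE (w : σ → ℕ) (e : ℕ) (f : MvPolynomial σ k) (d : σ →₀ ℕ) :
    coeff d (truncGE w e f) = if Finsupp.weight w d < e then 0 else coeff d f := by
  classical
  rw [truncGE_apply, coeff_sub, coeff_sum]
  simp_rw [coeff_weightedHomogeneousComponent]
  rw [Finset.sum_ite_eq]
  simp only [Finset.mem_range]
  split_ifs <;> simp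

lemma truncGE_mem (w : σ → ℕ) (e : ℕ) (f : MvPolynomial σ k) : truncGE w e f ∈ degGE w e := by
  intro d hd
  rw [coeff_truncGE, if_pos hd]

lemma truncGE_eq_self {w : σ → ℕ} {e : ℕ} {f : MvPolynomial σ k} (hf : f ∈ degGE w e) :
    truncGE w e f = f := by
  ext d
  rw [coeff_truncGE]
  split_ifs with h
  · exact (hf d h).symm
  · rfl

lemma truncGE_mul {w : σ → ℕ} {c : ℕ} {a : MvPolynomial σ k} (ha : IsWeightedHomogeneous w a c)
    (e : ℕ) (f : MvPolynomial σ k) : truncGE w (c + e) (a * f) = a * truncGE w e f := by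
  have h : ∀ i, i < c → weightedHomogeneousComponent w i (a * f) = 0 := by
    classical
    intro i hi
    ext d
    rw [coeff_weightedHomogeneousComponent]
    split_ifs with h
    · exact (degGE w c).mul_mem_right f ha.mem_degGE d (h ▸ hi)
    · simp
  rw [truncGE_apply, truncGE_apply, Finset.sum_range_add,
    Finset.sum_eq_zero fun i hi => h i (Finset.mem_range.1 hi), zero_add, mul_sub, Finset.mul_sum]
  simp_rw [weightedHomogeneousComponent_mul_of_isWeightedHomogeneous ha]

end DegreeFiltration

section QuotientSequence

variable {R : Type} [CommRing R] {I K Q : Ideal R} {x : R}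

lemma exact_mul_quotient (h : ∀ f, x * f ∈ K ↔ f ∈ I) (hQ : Q = K ⊔ Ideal.span {x}) :
    ∃ (f : (R ⧸ I) →ₗ[R] R ⧸ K) (g : (R ⧸ K) →ₗ[R] R ⧸ Q), Function.Exact f g ∧
      Function.Injective f ∧ Function.Surjective g := by
  have hKQ : K ≤ Q := hQ ▸ le_sup_left
  have hIK : I ≤ Submodule.comap (LinearMap.mulLeft R x) K := fun f hf => (h f).2 hf
  refine ⟨Submodule.mapQ I K (LinearMap.mulLeft R x) hIK,
    Submodule.mapQ K Q LinearMap.id hKQ, ?_, ?_, ?_⟩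
  · intro b
    obtain ⟨b, rfl⟩ := Submodule.Quotient.mk_surjective _ b
    rw [Submodule.mapQ_apply, LinearMap.id_apply, Submodule.Quotient.mk_eq_zero, hQ]
    constructor
    · intro hb
      obtain ⟨u, hu, v, hv, rfl⟩ := Submodule.mem_sup.1 hb
      obtain ⟨c, rfl⟩ := Ideal.mem_span_singleton'.1 hv
      refine ⟨Submodule.Quotient.mk c, ?_⟩
      rw [Submodule.mapQ_apply, Submodule.Quotient.eq, LinearMap.mulLeft_apply]
      have : x * c - (u + c * x) = -u := by ring
      rw [this]
      exact neg_mem hu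
    · rintro ⟨c, hc⟩
      obtain ⟨c, rfl⟩ := Submodule.Quotient.mk_surjective _ c
      rw [Submodule.mapQ_apply, Submodule.Quotient.eq, LinearMap.mulLeft_apply] at hc
      have : b = -(x * c - b) + c * x := by ring
      rw [this]
      exact Ideal.add_mem _ (Ideal.mem_sup_left (neg_mem hc))
        (Ideal.mem_sup_right (Ideal.mul_mem_left _ _ (Ideal.mem_span_singleton_self x)))
  · rw [← LinearMap.ker_eq_bot, LinearMap.ker_eq_bot']
    intro b hb
    obtain ⟨b, rfl⟩ := Submodule.Quotient.mk_surjective _ b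
    rw [Submodule.mapQ_apply, Submodule.Quotient.mk_eq_zero, LinearMap.mulLeft_apply, h] at hb
    exact (Submodule.Quotient.mk_eq_zero _).2 hb
  · intro b
    obtain ⟨b, rfl⟩ := Submodule.Quotient.mk_surjective _ b
    exact ⟨Submodule.Quotient.mk b, rfl⟩

end QuotientSequence

section DegreeFiltrationPd


variable {k σ : Type} [Field k]

lemma pdLT_quotient_degGE [DecidableEq σ] (s : Finset σ) (e : ℕ) :
    PdLT (MvPolynomial σ k)
      (MvPolynomial σ k ⧸ (degGE (fun i => if i ∈ s then 1 else 0) e : Ideal (MvPolynomial σ k)))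
      (s.card + 1) := by
  induction s using Finset.induction_on generalizing e with
  | empty =>
    cases e with
    | zero =>
      rw [degGE_zero]
      have : Subsingleton (MvPolynomial σ k ⧸ (⊤ : Ideal (MvPolynomial σ k))) :=
        Ideal.Quotient.subsingleton_iff.2 rfl
      exact pdLT_of_projective le_add_self
    | succ e =>
      have h : degGE (fun i => if i ∈ (∅ : Finset σ) then 1 else 0) (e + 1) =
          (⊥ : Ideal (MvPolynomial σ k)) := by
        rw [eq_bot_iff]
        intro f hf
        rw [Ideal.mem_bot]
        ext d
        rw [coeff_zero]
        refine hf d ?_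
        simp [Finsupp.weight_apply]
      refine pdLT_of_equiv (Submodule.quotEquivOfEqBot _ h).symm (pdLT_of_projective ?_)
      simp
  | insert i s hi ih =>
    rw [Finset.card_insert_of_notMem hi]
    induction e with
    | zero =>
      rw [degGE_zero]
      have : Subsingleton (MvPolynomial σ k ⧸ (⊤ : Ideal (MvPolynomial σ k))) :=
        Ideal.Quotient.subsingleton_iff.2 rfl
      exact pdLT_of_projective le_add_self
    | succ e ihe =>
      set w : σ → ℕ := fun j => if j ∈ s then 1 else 0 with hw
      set w' : σ → ℕ := fun j => if j ∈ insert i s then 1 else 0 with hw'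
      have hwi : w i = 0 := by simp [hw, hi]
      have hwi' : w' i = 1 := by simp [hw']
      have hww : ∀ d : σ →₀ ℕ, Finsupp.weight w' d = d i + Finsupp.weight w d := by
        intro d
        have : w' = w + Pi.single i 1 := by
          funext j
          by_cases hj : j = i
          · subst hj; simp [hw, hw', hi]
          · simp [hw, hw', hj]
        rw [Finsupp.weight_apply, Finsupp.weight_apply, this, add_comm, Finsupp.sum, Finsupp.sum]
        simp only [Pi.add_apply, smul_add, Finset.sum_add_distrib]
        congr 1
        rw [Finset.sum_eq_single i]
        · simp
        · intro j _ hj; simp [hj]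
        · intro h; simpa using h
      have hsup : (degGE w' (e + 1) ⊔ Ideal.span {X i} : Ideal (MvPolynomial σ k)) =
          degGE w (e + 1) ⊔ Ideal.span {X i} := by
        refine le_antisymm (sup_le ?_ le_sup_right) (sup_le (le_trans ?_ le_sup_left) le_sup_right)
        · intro f hf
          rw [f.as_sum]
          refine Ideal.sum_mem _ fun d hd => ?_
          by_cases hdi : d i = 0
          · refine Ideal.mem_sup_left fun d' hd' => ?_
            rw [coeff_monomial]
            split_ifs with h
            · subst h
              exact hf d (by rw [hww, hdi, zero_add]; exact hd')
            · rfl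
          · refine Ideal.mem_sup_right (Ideal.mem_span_singleton.2 ?_)
            rw [X_dvd_monomial]
            exact Or.inr hdi
        · intro f hf d hd
          rw [hww] at hd
          exact hf d (by omega)
      have hreg : ∀ f : MvPolynomial σ k, X i * f ∈ (degGE w (e + 1) : Ideal (MvPolynomial σ k)) ↔
          f ∈ (degGE w (e + 1) : Ideal (MvPolynomial σ k)) := by
        refine fun f => ⟨fun h d hd => ?_, fun h => Ideal.mul_mem_left _ _ h⟩
        have := h (Finsupp.single i 1 + d) (by
          rw [map_add, Finsupp.weight_single, hwi]
          simpa using hd)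
        rwa [coeff_X_mul] at this
      obtain ⟨f₁, g₁, hex₁, hf₁, hg₁⟩ := exact_mul_quotient hreg rfl
      obtain ⟨f₂, g₂, hex₂, hf₂, hg₂⟩ :=
        exact_mul_quotient (fun f => X_mul_mem_degGE_iff (e := e) hwi' (f := f)) hsup.symm
      exact pdLT_mid hex₂ hf₂ hg₂ ihe
        (pdLT_right hex₁ hf₁ hg₁ (ih (e + 1)) (pdLT_mono (by omega) (ih (e + 1))))

lemma pdLT_degGE [DecidableEq σ] (s : Finset σ) (hs : s.Nonempty) (e : ℕ) :
    PdLT (MvPolynomial σ k)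
      (degGE (fun i => if i ∈ s then 1 else 0) e : Ideal (MvPolynomial σ k)) s.card :=
  pdLT_left (f := Submodule.subtype _) (g := Submodule.mkQ _)
    (LinearMap.exact_subtype_mkQ _) Subtype.val_injective (Submodule.mkQ_surjective _)
    (pdLT_of_projective hs.card_pos) (pdLT_quotient_degGE s e)

end DegreeFiltrationPd

section Fermions

variable {R E F : Type} [CommRing R] [AddCommGroup E] [Module R E] [AddCommGroup F] [Module R F]
  {r : ℕ}

/-- The sign `(-1)^#{i ∈ I | i < j}`. -/
def ksign (R : Type) [CommRing R] {r : ℕ} (j : Fin r) (I : Finset (Fin r)) : R :=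
  (-1) ^ (I.filter (· < j)).card

lemma ksign_insert {i j : Fin r} {I : Finset (Fin r)} (hi : i ∉ I) :
    ksign R j (insert i I) = if i < j then -ksign R j I else ksign R j I := by
  rw [ksign, ksign, Finset.filter_insert]
  split_ifs with h
  · rw [Finset.card_insert_of_notMem (by simp [hi]), pow_succ, mul_neg_one]
  · rfl

lemma ksign_insert_self (j : Fin r) (I : Finset (Fin r)) :
    ksign R j (insert j I) = ksign R j I := by
  rw [ksign, ksign, Finset.filter_insert, if_neg (lt_irrefl j)]

lemma ksign_erase_self (j : Fin r) (I : Finset (Fin r)) :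
    ksign R j (I.erase j) = ksign R j I := by
  rw [← ksign_insert_self j (I.erase j)]
  by_cases h : j ∈ I
  · rw [Finset.insert_erase h]
  · rw [Finset.erase_eq_of_notMem h, ksign_insert_self]

lemma ksign_mul_self (j : Fin r) (I : Finset (Fin r)) : ksign R j I * ksign R j I = 1 := by
  rw [ksign, ← pow_add, ← two_mul, pow_mul]
  simp

/-- Exterior multiplication by the basis vector `j` on `⋀ Rʳ ⊗ E`. -/
def wedge (R E : Type) [CommRing R] [AddCommGroup E] [Module R E] {r : ℕ} (j : Fin r) :
    (Finset (Fin r) → E) →ₗ[R] (Finset (Fin r) → E) where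
  toFun ω I := if j ∈ I then ksign R j I • ω (I.erase j) else 0
  map_add' ω ω' := by
    funext I
    by_cases h : j ∈ I <;> simp [h]
  map_smul' c ω := by
    funext I
    by_cases h : j ∈ I <;> simp [h, smul_comm c]

/-- Contraction with the basis vector `j` on `⋀ Rʳ ⊗ E`. -/
def contr (R E : Type) [CommRing R] [AddCommGroup E] [Module R E] {r : ℕ} (j : Fin r) :
    (Finset (Fin r) → E) →ₗ[R] (Finset (Fin r) → E) where
  toFun ω I := if j ∈ I then 0 else ksign R j I • ω (insert j I)
  map_add' ω ω' := by
    funext I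
    by_cases h : j ∈ I <;> simp [h]
  map_smul' c ω := by
    funext I
    by_cases h : j ∈ I <;> simp [h, smul_comm c]

lemma wedge_apply (j : Fin r) (ω : Finset (Fin r) → E) (I : Finset (Fin r)) :
    wedge R E j ω I = if j ∈ I then ksign R j I • ω (I.erase j) else 0 := rfl

lemma contr_apply (j : Fin r) (ω : Finset (Fin r) → E) (I : Finset (Fin r)) :
    contr R E j ω I = if j ∈ I then 0 else ksign R j I • ω (insert j I) := rfl

lemma ksign_exchange {i j : Fin r} (hij : i ≠ j) {I : Finset (Fin r)} (hi : i ∉ I) (hj : j ∉ I) :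
    ksign R i I * ksign R j (insert i I) = -(ksign R j I * ksign R i (insert j I)) := by
  rw [ksign_insert hi, ksign_insert hj]
  rcases lt_or_gt_of_ne hij with h | h
  · rw [if_pos h, if_neg h.not_gt]; ring
  · rw [if_neg h.not_gt, if_pos h]; ring

lemma wedge_wedge_self (i : Fin r) : wedge R E i * wedge R E i = 0 := by
  refine LinearMap.ext fun ω => ?_
  funext I
  simp [wedge_apply]

lemma contr_contr_self (i : Fin r) : contr R E i * contr R E i = 0 := by
  refine LinearMap.ext fun ω => ?_
  funext I
  simp [contr_apply]

lemma contr_contr (i j : Fin r) : contr R E i * contr R E j = -(contr R E j * contr R E i) := by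
  by_cases hij : i = j
  · subst hij; rw [contr_contr_self, neg_zero]
  refine LinearMap.ext fun ω => ?_
  funext I
  simp only [Module.End.mul_apply, contr_apply, LinearMap.neg_apply, Pi.neg_apply]
  by_cases hi : i ∈ I
  · simp [hi]
  by_cases hj : j ∈ I
  · simp [hj]
  simp only [hi, hj, if_false, Finset.mem_insert, or_false, hij, Ne.symm hij, smul_smul]
  rw [ksign_exchange hij hi hj, neg_smul, Finset.insert_comm]

lemma wedge_wedge (i j : Fin r) : wedge R E i * wedge R E j = -(wedge R E j * wedge R E i) := by
  by_cases hij : i = j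
  · subst hij; rw [wedge_wedge_self, neg_zero]
  refine LinearMap.ext fun ω => ?_
  funext I
  simp only [Module.End.mul_apply, wedge_apply, LinearMap.neg_apply, Pi.neg_apply]
  by_cases hi : i ∈ I
  swap
  · simp [hi]
  by_cases hj : j ∈ I
  swap
  · simp [hj]
  obtain ⟨I, hiI, rfl⟩ : ∃ I', i ∉ I' ∧ I = insert i I' :=
    ⟨I.erase i, by simp, (Finset.insert_erase hi).symm⟩
  replace hj : j ∈ I := by simpa [Ne.symm hij] using hj
  obtain ⟨I, hjI, rfl⟩ : ∃ I', j ∉ I' ∧ I = insert j I' :=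
    ⟨I.erase j, by simp, (Finset.insert_erase hj).symm⟩
  replace hiI : i ∉ I := fun h => hiI (by simp [h])
  have h1 : (insert i (insert j I)).erase i = insert j I :=
    Finset.erase_insert (by simp [hij, hiI])
  have h2 : (insert i (insert j I)).erase j = insert i I := by
    rw [Finset.insert_comm]
    exact Finset.erase_insert (by simp [Ne.symm hij, hjI])
  have h3 : (insert j I).erase j = I := Finset.erase_insert hjI
  have h4 : (insert i I).erase i = I := Finset.erase_insert hiI
  simp only [h1, h2, h3, h4, Finset.mem_insert, true_or, or_true, if_true, smul_smul,
    ksign_insert_self]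
  rw [Finset.insert_comm i j, ksign_insert_self, ← neg_smul, mul_comm,
    mul_comm (ksign R j (insert i I)), ksign_exchange hij hiI hjI, neg_neg]

lemma wedge_contr_of_ne {i j : Fin r} (hij : i ≠ j) :
    wedge R E i * contr R E j = -(contr R E j * wedge R E i) := by
  refine LinearMap.ext fun ω => ?_
  funext I
  simp only [Module.End.mul_apply, wedge_apply, contr_apply, LinearMap.neg_apply, Pi.neg_apply]
  by_cases hj : j ∈ I
  · simp [hj, Ne.symm hij]
  by_cases hi : i ∈ I
  swap
  · simp [hi, hij]
  obtain ⟨I, hiI, rfl⟩ : ∃ I', i ∉ I' ∧ I = insert i I' :=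
    ⟨I.erase i, by simp, (Finset.insert_erase hi).symm⟩
  replace hj : j ∉ I := fun h => hj (by simp [h])
  have h1 : (insert i I).erase i = I := Finset.erase_insert hiI
  have h2 : (insert j (insert i I)).erase i = insert j I := by
    rw [Finset.insert_comm]
    exact Finset.erase_insert (by simp [hij, hiI])
  simp only [h1, h2, Finset.mem_insert, true_or, or_true, if_true, smul_smul, hj, or_false,
    Ne.symm hij, if_false, ksign_insert_self]
  rw [Finset.insert_comm j i, ksign_insert_self, ksign_insert hj, ksign_insert hiI, ← neg_smul]
  congr 1
  rcases lt_or_gt_of_ne hij with h | h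
  · rw [if_pos h, if_neg h.not_gt]; ring
  · rw [if_neg h.not_gt, if_pos h]; ring

lemma wedge_contr_self (i : Fin r) :
    wedge R E i * contr R E i + contr R E i * wedge R E i = 1 := by
  refine LinearMap.ext fun ω => ?_
  funext I
  simp only [LinearMap.add_apply, Pi.add_apply, Module.End.mul_apply, wedge_apply, contr_apply,
    Module.End.one_apply]
  by_cases hi : i ∈ I
  · simp [hi, smul_smul, ksign_erase_self, ksign_mul_self, Finset.insert_erase]
  · simp [hi, smul_smul, ksign_insert_self, ksign_mul_self]

/-- The form `ω` is concentrated in exterior degree `d`. -/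
def IsForm (d : ℕ) (ω : Finset (Fin r) → E) : Prop := ∀ I, I.card ≠ d → ω I = 0

lemma IsForm.wedge {d : ℕ} {ω : Finset (Fin r) → E} (h : IsForm d ω) (j : Fin r) :
    IsForm (d + 1) (wedge R E j ω) := by
  intro I hI
  rw [wedge_apply]
  split_ifs with hj
  · rw [h _ (by rw [Finset.card_erase_of_mem hj]; have := Finset.card_pos.2 ⟨j, hj⟩; omega),
      smul_zero]
  · rfl

lemma IsForm.contr {d : ℕ} {ω : Finset (Fin r) → E} (h : IsForm (d + 1) ω) (j : Fin r) :
    IsForm d (contr R E j ω) := by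
  intro I hI
  rw [contr_apply]
  split_ifs with hj
  · rfl
  · rw [h _ (by rw [Finset.card_insert_of_notMem hj]; omega), smul_zero]

lemma IsForm.contr_zero {ω : Finset (Fin r) → E} (h : IsForm 0 ω) (j : Fin r) :
    _root_.contr R E j ω = 0 := by
  funext I
  rw [contr_apply]
  split_ifs with hj
  · rfl
  · rw [h _ (by rw [Finset.card_insert_of_notMem hj]; omega), smul_zero]; rfl

lemma IsForm.smul {d : ℕ} {ω : Finset (Fin r) → E} (h : IsForm d ω) (c : R) :
    IsForm d (c • ω) := fun I hI => by rw [Pi.smul_apply, h I hI, smul_zero]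

lemma IsForm.sum {ι : Type} {s : Finset ι} {d : ℕ} {ω : ι → Finset (Fin r) → E}
    (h : ∀ i ∈ s, IsForm d (ω i)) : IsForm d (∑ i ∈ s, ω i) := fun I hI => by
  rw [Finset.sum_apply]
  exact Finset.sum_eq_zero fun i hi => h i hi I hI

lemma IsForm.eq_zero_of_lt {d : ℕ} {ω : Finset (Fin r) → E} (h : IsForm d ω) (hd : r < d) :
    ω = 0 := by
  funext I
  refine h I ?_
  have := Finset.card_le_univ I
  rw [Fintype.card_fin] at this
  omega

/-- The component of a form in exterior degree `d`. -/
def formPart (R E : Type) [CommRing R] [AddCommGroup E] [Module R E] (r d : ℕ) :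
    (Finset (Fin r) → E) →ₗ[R] (Finset (Fin r) → E) where
  toFun ω I := if I.card = d then ω I else 0
  map_add' ω ω' := by
    funext I
    by_cases h : I.card = d <;> simp [h]
  map_smul' c ω := by
    funext I
    by_cases h : I.card = d <;> simp [h]

lemma formPart_apply (d : ℕ) (ω : Finset (Fin r) → E) (I : Finset (Fin r)) :
    formPart R E r d ω I = if I.card = d then ω I else 0 := rfl

lemma isForm_formPart (d : ℕ) (ω : Finset (Fin r) → E) : IsForm d (formPart R E r d ω) :=
  fun I hI => by rw [formPart_apply, if_neg hI]

lemma IsForm.formPart_eq {d : ℕ} {ω : Finset (Fin r) → E} (h : IsForm d ω) :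
    formPart R E r d ω = ω := by
  funext I
  rw [formPart_apply]
  split_ifs with hI
  · rfl
  · exact (h I hI).symm

lemma formPart_wedge (d : ℕ) (j : Fin r) (ω : Finset (Fin r) → E) :
    formPart R E r (d + 1) (wedge R E j ω) = wedge R E j (formPart R E r d ω) := by
  funext I
  rw [formPart_apply, wedge_apply, wedge_apply]
  by_cases hj : j ∈ I
  · rw [if_pos hj, if_pos hj, formPart_apply, Finset.card_erase_of_mem hj]
    have := Finset.card_pos.2 ⟨j, hj⟩
    by_cases h : I.card = d + 1
    · rw [if_pos h, if_pos (by omega)]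
    · rw [if_neg h, if_neg (by omega), smul_zero]
  · simp [hj]

lemma formPart_zero_wedge (j : Fin r) (ω : Finset (Fin r) → E) :
    formPart R E r 0 (wedge R E j ω) = 0 := by
  funext I
  rw [formPart_apply, wedge_apply]
  by_cases h : I.card = 0
  · rw [Finset.card_eq_zero.1 h]; simp
  · rw [if_neg h]; rfl

lemma formPart_contr (d : ℕ) (j : Fin r) (ω : Finset (Fin r) → E) :
    formPart R E r d (contr R E j ω) = contr R E j (formPart R E r (d + 1) ω) := by
  funext I
  rw [formPart_apply, contr_apply, contr_apply]
  by_cases hj : j ∈ I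
  · simp [hj]
  · rw [if_neg hj, if_neg hj, formPart_apply, Finset.card_insert_of_notMem hj]
    by_cases h : I.card = d
    · rw [if_pos h, if_pos (by omega)]
    · rw [if_neg h, if_neg (by omega), smul_zero]

end Fermions

section Fock

variable {R E κ : Type} [CommRing R] [AddCommGroup E] [Module R E]

/-- The operators `e i` and `c i` satisfy canonical anticommutation relations with `e i` and `c i`
having anticommutator multiplication by `Δ`. -/
structure IsCAR (e c : κ → Module.End R E) (Δ : R) : Prop where
  ee : ∀ i j, e i * e j = -(e j * e i)
  ee_self : ∀ i, e i * e i = 0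
  cc : ∀ i j, c i * c j = -(c j * c i)
  cc_self : ∀ i, c i * c i = 0
  ec : ∀ i j, i ≠ j → e i * c j = -(c j * e i)
  ec_self : ∀ i, e i * c i + c i * e i = Δ • 1

/-- The differential `∑ i ∈ l, x i • e i`. -/
def listD (x : κ → R) (e : κ → Module.End R E) (l : List κ) : Module.End R E :=
  (l.map fun i => x i • e i).sum

/-- The operator `c iₛ * ⋯ * c i₁` for `l = [i₁, …, iₛ]`. -/
def listC (c : κ → Module.End R E) : List κ → Module.End R E
  | [] => 1
  | a :: l => listC c l * c a

/-- The submodule `(x i : i ∈ l) E`. -/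
def listX (E : Type) [AddCommGroup E] [Module R E] (x : κ → R) (l : List κ) : Submodule R E :=
  Ideal.span {y | ∃ i ∈ l, x i = y} • ⊤

section

variable {x : κ → R} {e c : κ → Module.End R E} {Δ : R} {l : List κ} {a : κ}

lemma listD_cons : listD x e (a :: l) = x a • e a + listD x e l := by
  simp [listD]

lemma listX_cons : listX E x (a :: l) = Ideal.span {x a} • ⊤ ⊔ listX E x l := by
  rw [listX, listX, ← Submodule.sup_smul, ← Ideal.span_union]
  congr 2
  ext y
  simp [eq_comm]

lemma smul_mem_listX (ha : a ∈ l) (g : E) : x a • g ∈ listX E x l :=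
  Submodule.smul_mem_smul (Ideal.subset_span ⟨a, ha, rfl⟩) trivial

lemma map_mem_listX (f : Module.End R E) {g : E} (hg : g ∈ listX E x l) : f g ∈ listX E x l := by
  have : (listX E x l).map f ≤ listX E x l := by
    rw [listX, Submodule.map_smul'']
    exact Submodule.smul_mono le_rfl le_top
  exact this (Submodule.mem_map_of_mem hg)

lemma listD_mem_listX (g : E) : listD x e l g ∈ listX E x l := by
  induction l with
  | nil => simp [listD]
  | cons a l ih =>
    rw [listD_cons, LinearMap.add_apply, LinearMap.smul_apply]
    refine add_mem (smul_mem_listX List.mem_cons_self _) ?_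
    rw [listX_cons]
    exact Submodule.mem_sup_right ih

namespace IsCAR

variable (h : IsCAR e c Δ)
include h

lemma e_mul_listD (j : κ) : e j * listD x e l = -(listD x e l * e j) := by
  induction l with
  | nil => simp [listD]
  | cons a l ih =>
    rw [listD_cons, mul_add, add_mul, neg_add, ih, mul_smul_comm, smul_mul_assoc, h.ee j a, smul_neg]

lemma c_mul_listD {j : κ} (hj : j ∉ l) : c j * listD x e l = -(listD x e l * c j) := by
  induction l with
  | nil => simp [listD]
  | cons a l ih =>
    rw [List.mem_cons, not_or] at hj
    rw [listD_cons, mul_add, add_mul, neg_add, ih hj.2, mul_smul_comm, smul_mul_assoc,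
      h.ec a j (Ne.symm hj.1), smul_neg, neg_neg]

lemma c_mul_listC (j : κ) : c j * listC c l = (-1) ^ l.length * (listC c l * c j) := by
  induction l with
  | nil => simp [listC]
  | cons a l ih =>
    rw [listC, ← mul_assoc, ih, List.length_cons, pow_succ, mul_assoc, mul_assoc, h.cc j a]
    simp [mul_assoc]

lemma c_mul_prod {j : κ} (hj : j ∉ l) :
    c j * (l.map e).prod = (-1) ^ l.length * ((l.map e).prod * c j) := by
  induction l with
  | nil => simp
  | cons a l ih =>
    rw [List.mem_cons, not_or] at hj
    have h1 : c j * e a = -(e a * c j) := by rw [h.ec a j (Ne.symm hj.1), neg_neg]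
    rw [List.map_cons, List.prod_cons, ← mul_assoc, h1, List.length_cons, pow_succ, neg_mul,
      mul_assoc, ih hj.2]
    rcases neg_one_pow_eq_or (Module.End R E) l.length with hs | hs <;> simp [hs, mul_assoc]

lemma listD_mul_prod : listD x e l * (l.map e).prod = 0 := by
  induction l with
  | nil => simp [listD]
  | cons a l ih =>
    rw [listD_cons, List.map_cons, List.prod_cons, add_mul, smul_mul_assoc, ← mul_assoc (e a),
      h.ee_self, zero_mul, smul_zero, zero_add, ← mul_assoc,
      show listD x e l * e a = -(e a * listD x e l) by rw [h.e_mul_listD, neg_neg], neg_mul,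
      mul_assoc, ih, mul_zero, neg_zero]

lemma listC_prod_listC (hl : l.Nodup) :
    listC c l * (l.map e).prod * listC c l = Δ ^ l.length • listC c l := by
  induction l with
  | nil => simp [listC]
  | cons a l ih =>
    rw [List.nodup_cons] at hl
    have h1 : c a * e a = Δ • 1 - e a * c a := by rw [← h.ec_self a]; abel
    have h2 : c a * ((l.map e).prod * (listC c l * c a)) = 0 := by
      rw [← mul_assoc, h.c_mul_prod hl.1, mul_assoc, mul_assoc, ← mul_assoc (c a), h.c_mul_listC,
        mul_assoc, mul_assoc (listC c l), h.cc_self]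
      simp
    calc listC c (a :: l) * ((a :: l).map e).prod * listC c (a :: l)
        = listC c l * ((c a * e a) * ((l.map e).prod * (listC c l * c a))) := by
          simp only [listC, List.map_cons, List.prod_cons, mul_assoc]
      _ = Δ • (listC c l * (l.map e).prod * listC c l * c a) := by
          rw [h1, sub_mul, mul_assoc (e a), h2, mul_zero, sub_zero, smul_mul_assoc, one_mul,
            mul_smul_comm]
          simp only [mul_assoc]
      _ = Δ ^ (a :: l).length • listC c (a :: l) := by
          rw [ih hl.2, smul_mul_assoc, smul_smul, List.length_cons, pow_succ', listC]

/-- A cocycle for `∑ x i • e i` whose full contraction lies in `(x) E` is a coboundary after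
multiplication by a power of `Δ`, provided that the `x i` form a regular sequence. -/
theorem exists_pow_smul_eq_listD (hl : l.Nodup)
    (hreg : ∀ (a : κ) (s : List κ), a ∉ s → ∀ g : E, x a • g ∈ listX E x s → g ∈ listX E x s)
    {ω : E} (hω : listD x e l ω = 0) (hc : listC c l ω ∈ listX E x l) :
    ∃ (s : ℕ) (η : E), Δ ^ s • ω = listD x e l η := by
  induction l generalizing ω with
  | nil =>
    refine ⟨0, 0, ?_⟩
    simpa [listC, listX] using hc
  | cons a l ih =>
    rw [List.nodup_cons] at hl
    set D := listD x e l with hD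
    set β := c a ω with hβ
    set α := c a (e a ω) with hα
    have hDω : D ω = -(x a • e a ω) := by
      rw [listD_cons, LinearMap.add_apply, LinearMap.smul_apply, add_comm] at hω
      exact eq_neg_of_add_eq_zero_left hω
    have hΔω : Δ • ω = e a β + α := by
      have := LinearMap.congr_fun (h.ec_self a) ω
      simpa using this.symm
    have hee : ∀ v, e a (e a v) = 0 := fun v => LinearMap.congr_fun (h.ee_self a) v
    have heD : ∀ v, e a (D v) = -D (e a v) := fun v => LinearMap.congr_fun (h.e_mul_listD a) v
    have hcD : ∀ v, D (c a v) = -c a (D v) := fun v => by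
      have := LinearMap.congr_fun (h.c_mul_listD (x := x) hl.1) v
      simp only [Module.End.mul_apply, LinearMap.neg_apply] at this
      rw [this, neg_neg]
    have hDα : D α = 0 := by
      rw [hα, hcD, show D (e a ω) = -e a (D ω) by rw [heD, neg_neg], hDω]
      simp [hee]
    have hDβ : D β = x a • α := by
      rw [hβ, hcD, hDω]
      simp [hα]
    have hCD : ∀ v, listC c l (D v) ∈ listX E x l := fun v => map_mem_listX _ (listD_mem_listX v)
    have hCα : listC c l α ∈ listX E x l := by
      refine hreg a l hl.1 _ ?_
      rw [← map_smul, ← hDβ]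
      exact hCD β
    obtain ⟨s, γ₀, hγ₀⟩ := ih hl.2 hDα hCα
    obtain ⟨μ, ξ, hξ, hμ⟩ : ∃ μ ξ, ξ ∈ listX E x l ∧ listC c l β = x a • μ + ξ := by
      have h1 : listC c l β ∈ listX E x (a :: l) := hc
      rw [listX_cons, Submodule.ideal_span_singleton_smul] at h1
      obtain ⟨y, hy, ξ, hξ, hyξ⟩ := Submodule.mem_sup.1 h1
      obtain ⟨μ, -, rfl⟩ := (Submodule.mem_smul_pointwise_iff_exists _ _ _).1 hy
      exact ⟨μ, ξ, hξ, hyξ.symm⟩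
    set N := l.length with hN
    set ν := Δ ^ s • μ - listC c l γ₀ with hν
    set γ := Δ ^ N • γ₀ + (l.map e).prod ν with hγ
    have hDγ : D γ = Δ ^ N • D γ₀ := by
      have := LinearMap.congr_fun (h.listD_mul_prod (x := x) (l := l)) ν
      simp only [Module.End.mul_apply, LinearMap.zero_apply] at this
      rw [hγ, map_add, map_smul, hD, this, add_zero]
    have hD' : D (Δ ^ (N + s) • β - x a • γ) = 0 := by
      rw [map_sub, map_smul, map_smul, hDγ, hDβ, ← hγ₀]
      module
    have hkey : x a • ν = listC c l (Δ ^ s • β - x a • γ₀) - Δ ^ s • ξ := by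
      rw [map_sub, map_smul, map_smul, hμ, hν, smul_add, smul_sub, smul_comm (x a)]
      abel
    have hC' : listC c l (Δ ^ (N + s) • β - x a • γ) ∈ listX E x l := by
      have h1 : listC c l ((l.map e).prod (x a • ν)) - Δ ^ N • (x a • ν) ∈ listX E x l := by
        have h2 := LinearMap.congr_fun (h.listC_prod_listC hl.2) (Δ ^ s • β - x a • γ₀)
        simp only [Module.End.mul_apply, LinearMap.smul_apply] at h2
        rw [hkey, map_sub, map_sub, h2, smul_sub, sub_sub_sub_cancel_left]
        refine sub_mem (Submodule.smul_mem _ _ (Submodule.smul_mem _ _ hξ)) ?_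
        exact map_mem_listX _ (map_mem_listX _ (Submodule.smul_mem _ _ hξ))
      have h3 : listC c l (Δ ^ (N + s) • β - x a • γ) = Δ ^ (N + s) • ξ -
          (listC c l ((l.map e).prod (x a • ν)) - Δ ^ N • (x a • ν)) := by
        rw [map_sub, map_smul, hμ, hγ, map_smul, map_add, map_smul, map_smul, map_smul, hν,
          smul_add, smul_add, pow_add]
        module
      rw [h3]
      exact sub_mem (Submodule.smul_mem _ _ hξ) h1
    obtain ⟨t, η, hη⟩ := ih hl.2 hD' hC'
    refine ⟨t + (N + s) + 1, Δ ^ t • γ - e a η, ?_⟩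
    have hβ' : Δ ^ (t + (N + s)) • β = D η + Δ ^ t • x a • γ := by
      rw [← hη, smul_sub, smul_smul, pow_add]
      abel
    rw [pow_succ, mul_smul, hΔω, smul_add, ← map_smul, hβ', map_add, heD, listD_cons,
      LinearMap.add_apply, LinearMap.smul_apply, map_sub, hee, map_sub, map_smul, map_smul,
      map_smul, map_smul, ← hD, hDγ, ← hγ₀, pow_add, pow_add]
    module

end IsCAR

end

end Fock

section Koszul

variable {R E : Type} [CommRing R] [AddCommGroup E] [Module R E] {r : ℕ}

lemma sum_smul_mul_sum_smul_anticomm {ι A : Type} [Ring A] [Algebra R A] {s t : Finset ι}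
    {a b : ι → R} {u v : ι → A} (h : ∀ i ∈ s, ∀ j ∈ t, u i * v j = -(v j * u i)) :
    (∑ i ∈ s, a i • u i) * (∑ j ∈ t, b j • v j) =
      -((∑ j ∈ t, b j • v j) * (∑ i ∈ s, a i • u i)) := by
  rw [Finset.sum_mul_sum, Finset.sum_mul_sum, Finset.sum_comm, ← Finset.sum_neg_distrib]
  refine Finset.sum_congr rfl fun j hj => ?_
  rw [← Finset.sum_neg_distrib]
  refine Finset.sum_congr rfl fun i hi => ?_
  rw [smul_mul_smul_comm, smul_mul_smul_comm, h i hi j hj, smul_neg, mul_comm]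

lemma sum_smul_mul_self_eq_zero {ι A : Type} [Ring A] [Algebra R A] {s : Finset ι}
    {a : ι → R} {u : ι → A} (h : ∀ i j, u i * u j = -(u j * u i)) (h' : ∀ i, u i * u i = 0) :
    (∑ i ∈ s, a i • u i) * (∑ i ∈ s, a i • u i) = 0 := by
  classical
  induction s using Finset.induction_on with
  | empty => simp
  | insert j s hj ih =>
    have h1 : (a j • u j) * (∑ i ∈ s, a i • u i) = -((∑ i ∈ s, a i • u i) * (a j • u j)) := by
      have := sum_smul_mul_sum_smul_anticomm (s := {j}) (t := s) (a := a) (b := a) (u := u) (v := u)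
        (fun i _ j _ => h i j)
      simpa using this
    rw [Finset.sum_insert hj, add_mul, mul_add, mul_add, ih, h1, smul_mul_smul_comm, h' j]
    simp

/-- Exterior multiplication by the vector `a`. -/
def wedgeV (R E : Type) [CommRing R] [AddCommGroup E] [Module R E] {r : ℕ} (a : Fin r → R) :
    Module.End R (Finset (Fin r) → E) := ∑ j, a j • wedge R E j

/-- Contraction with the vector `a`. -/
def contrV (R E : Type) [CommRing R] [AddCommGroup E] [Module R E] {r : ℕ} (a : Fin r → R) :
    Module.End R (Finset (Fin r) → E) := ∑ j, a j • contr R E j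

lemma wedgeV_mul_wedgeV (a b : Fin r → R) :
    wedgeV R E a * wedgeV R E b = -(wedgeV R E b * wedgeV R E a) :=
  sum_smul_mul_sum_smul_anticomm fun i _ j _ => wedge_wedge i j

lemma contrV_mul_contrV (a b : Fin r → R) :
    contrV R E a * contrV R E b = -(contrV R E b * contrV R E a) :=
  sum_smul_mul_sum_smul_anticomm fun i _ j _ => contr_contr i j

lemma wedgeV_mul_self (a : Fin r → R) : wedgeV R E a * wedgeV R E a = 0 :=
  sum_smul_mul_self_eq_zero wedge_wedge wedge_wedge_self

lemma contrV_mul_self (a : Fin r → R) : contrV R E a * contrV R E a = 0 :=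
  sum_smul_mul_self_eq_zero contr_contr contr_contr_self

lemma wedge_mul_contr_add (i j : Fin r) :
    wedge R E i * contr R E j + contr R E j * wedge R E i = if i = j then 1 else 0 := by
  split_ifs with h
  · subst h; exact wedge_contr_self i
  · rw [wedge_contr_of_ne h, neg_add_cancel]

lemma wedgeV_mul_contrV (a b : Fin r → R) :
    wedgeV R E a * contrV R E b + contrV R E b * wedgeV R E a = (a ⬝ᵥ b) • 1 := by
  have h : ∀ i j, (a i • wedge R E i) * (b j • contr R E j) +
      (b j • contr R E j) * (a i • wedge R E i) = if i = j then (a i * b j) • 1 else 0 := by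
    intro i j
    rw [smul_mul_smul_comm, smul_mul_smul_comm, mul_comm (b j), ← smul_add, wedge_mul_contr_add]
    split_ifs <;> simp
  rw [wedgeV, contrV, Finset.sum_mul_sum, Finset.sum_mul_sum,
    Finset.sum_comm (f := fun i j => (b i • contr R E i) * (a j • wedge R E j)),
    ← Finset.sum_add_distrib]
  simp_rw [← Finset.sum_add_distrib, h]
  simp [dotProduct, Finset.sum_smul]

lemma IsForm.wedgeV {d : ℕ} {ω : Finset (Fin r) → E} (h : IsForm d ω) (a : Fin r → R) :
    IsForm (d + 1) (_root_.wedgeV R E a ω) := by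
  rw [_root_.wedgeV, LinearMap.sum_apply]
  exact IsForm.sum fun j _ => (h.wedge j).smul _

lemma IsForm.contrV {d : ℕ} {ω : Finset (Fin r) → E} (h : IsForm (d + 1) ω) (a : Fin r → R) :
    IsForm d (_root_.contrV R E a ω) := by
  rw [_root_.contrV, LinearMap.sum_apply]
  exact IsForm.sum fun j _ => (h.contr j).smul _

lemma IsForm.contrV_zero {ω : Finset (Fin r) → E} (h : IsForm 0 ω) (a : Fin r → R) :
    _root_.contrV R E a ω = 0 := by
  rw [_root_.contrV, LinearMap.sum_apply]
  exact Finset.sum_eq_zero fun j _ => by rw [LinearMap.smul_apply, h.contr_zero, smul_zero]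

lemma formPart_wedgeV (d : ℕ) (a : Fin r → R) (ω : Finset (Fin r) → E) :
    formPart R E r (d + 1) (wedgeV R E a ω) = wedgeV R E a (formPart R E r d ω) := by
  rw [wedgeV, LinearMap.sum_apply, LinearMap.sum_apply, map_sum]
  simp [formPart_wedge]

lemma formPart_zero_wedgeV (a : Fin r → R) (ω : Finset (Fin r) → E) :
    formPart R E r 0 (wedgeV R E a ω) = 0 := by
  rw [wedgeV, LinearMap.sum_apply, map_sum]
  simp [formPart_zero_wedge]

lemma formPart_contrV (d : ℕ) (a : Fin r → R) (ω : Finset (Fin r) → E) :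
    formPart R E r d (contrV R E a ω) = contrV R E a (formPart R E r (d + 1) ω) := by
  rw [contrV, LinearMap.sum_apply, LinearMap.sum_apply, map_sum]
  simp [formPart_contr]

lemma isCAR_contr_wedge : IsCAR (contr R E (r := r)) (wedge R E) (1 : R) where
  ee := contr_contr
  ee_self := contr_contr_self
  cc := wedge_wedge
  cc_self := wedge_wedge_self
  ec i j h := by rw [wedge_contr_of_ne (Ne.symm h), neg_neg]
  ec_self i := by rw [add_comm, wedge_contr_self, one_smul]

lemma isCAR_minor {n m : ℕ} (φ : Matrix (Fin n) (Fin m) R) (c : Fin n ↪ Fin m) :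
    IsCAR (fun i => wedgeV R E (φ i))
      (fun k => contrV R E fun j => ∑ b, if c b = j then (φ.submatrix id c).adjugate b k else 0)
      (φ.submatrix id c).det := by
  have key : ∀ i k, (φ i ⬝ᵥ fun j => ∑ b, if c b = j then (φ.submatrix id c).adjugate b k else 0) =
      if i = k then (φ.submatrix id c).det else 0 := by
    intro i k
    have h := congrFun (congrFun (Matrix.mul_adjugate (φ.submatrix id c)) i) k
    rw [Matrix.mul_apply, Matrix.smul_apply, Matrix.one_apply, smul_eq_mul, mul_ite, mul_one,
      mul_zero] at h
    rw [← h]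
    simp only [dotProduct, Finset.mul_sum, mul_ite, mul_zero]
    rw [Finset.sum_comm]
    simp
  refine ⟨fun _ _ => wedgeV_mul_wedgeV _ _, fun _ => wedgeV_mul_self _,
    fun _ _ => contrV_mul_contrV _ _, fun _ => contrV_mul_self _, fun i k h => ?_, fun i => ?_⟩
  · have := wedgeV_mul_contrV (E := E) (φ i)
      fun j => ∑ b, if c b = j then (φ.submatrix id c).adjugate b k else 0
    rw [key, if_neg h, zero_smul] at this
    exact eq_neg_of_add_eq_zero_left this
  · have := wedgeV_mul_contrV (E := E) (φ i)
      fun j => ∑ b, if c b = j then (φ.submatrix id c).adjugate b i else 0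
    rwa [key, if_pos rfl] at this

lemma wedgeV_vecMul {n m : ℕ} (x : Fin n → R) (φ : Matrix (Fin n) (Fin m) R) :
    wedgeV R E (Matrix.vecMul x φ) = ∑ i, x i • wedgeV R E (φ i) := by
  simp only [wedgeV, Matrix.vecMul, dotProduct, Finset.sum_smul, Finset.smul_sum, smul_smul]
  rw [Finset.sum_comm]

lemma listD_finRange {n : ℕ} (x : Fin n → R) (e : Fin n → Module.End R E) :
    listD x e (List.finRange n) = ∑ i, x i • e i := by
  rw [listD, Fin.sum_univ_def]

lemma listC_apply_eq_zero {κ : Type} {c : κ → Module.End R (Finset (Fin r) → E)}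
    (hc : ∀ k d ω, IsForm (d + 1) ω → IsForm d (c k ω)) (hc' : ∀ k ω, IsForm 0 ω → c k ω = 0)
    (l : List κ) {d : ℕ} {ω : Finset (Fin r) → E} (hω : IsForm d ω) (hd : d < l.length) :
    listC c l ω = 0 := by
  induction l generalizing d ω with
  | nil => simp at hd
  | cons a l ih =>
    rw [listC, Module.End.mul_apply]
    cases d with
    | zero => rw [hc' a ω hω, map_zero]
    | succ d => exact ih (hc a d ω hω) (by simpa using hd)

lemma mem_smul_top_pi_iff {ι : Type} [Finite ι] {I : Ideal R} {g : ι → R} :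
    g ∈ I • (⊤ : Submodule R (ι → R)) ↔ ∀ i, g i ∈ I := by
  classical
  have := Fintype.ofFinite ι
  constructor
  · intro h i
    refine Submodule.smul_induction_on (p := fun g => g i ∈ I) h (fun r hr g _ => ?_)
      fun f g hf hg => I.add_mem hf hg
    exact I.mul_mem_right _ hr
  · intro h
    rw [pi_eq_sum_univ' g]
    exact sum_mem fun i _ => Submodule.smul_mem_smul (h i) trivial

end Koszul

section Regular

variable {k σ : Type} [Field k] {n r : ℕ}

lemma mem_listX_pi_iff {ι κ : Type} [Finite ι] {x : κ → σ} {l : List κ}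
    {g : ι → MvPolynomial σ k} :
    g ∈ listX (ι → MvPolynomial σ k) (fun i => (MvPolynomial.X (x i) : MvPolynomial σ k)) l ↔
      ∀ i, ∀ d ∈ (g i).support, ∃ a ∈ l, d (x a) ≠ 0 := by
  rw [listX, mem_smul_top_pi_iff]
  refine forall_congr' fun i => ?_
  have : {y | ∃ i ∈ l, (MvPolynomial.X (x i) : MvPolynomial σ k) = y} =
      MvPolynomial.X '' {s | ∃ a ∈ l, x a = s} := by
    ext y
    constructor
    · rintro ⟨a, ha, rfl⟩; exact ⟨_, ⟨a, ha, rfl⟩, rfl⟩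
    · rintro ⟨_, ⟨a, ha, rfl⟩, rfl⟩; exact ⟨a, ha, rfl⟩
  rw [this, MvPolynomial.mem_ideal_span_X_image]
  simp

lemma mem_listX_of_X_smul_mem {ι κ : Type} [Finite ι] {x : κ → σ} (hx : Function.Injective x)
    {a : κ} {l : List κ} (ha : a ∉ l) {g : ι → MvPolynomial σ k}
    (hg : (MvPolynomial.X (x a) : MvPolynomial σ k) • g ∈
      listX (ι → MvPolynomial σ k) (fun i => (MvPolynomial.X (x i) : MvPolynomial σ k)) l) :
    g ∈ listX (ι → MvPolynomial σ k) (fun i => (MvPolynomial.X (x i) : MvPolynomial σ k)) l := by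
  classical
  rw [mem_listX_pi_iff] at hg ⊢
  intro i d hd
  obtain ⟨b, hb, hdb⟩ := hg i (Finsupp.single (x a) 1 + d) (by
    rw [Pi.smul_apply, smul_eq_mul, MvPolynomial.mem_support_iff, MvPolynomial.coeff_X_mul]
    exact MvPolynomial.mem_support_iff.1 hd)
  refine ⟨b, hb, ?_⟩
  rw [Finsupp.add_apply, Finsupp.single_eq_of_ne] at hdb
  · simpa using hdb
  · exact fun h => ha (hx h ▸ hb)

/-- Koszul cocycles of `x φ` become coboundaries after multiplication by powers of the maximal
minors of `φ`. -/
theorem exists_minor_pow_smul_eq {x : Fin n → σ} (hx : Function.Injective x) {m : ℕ}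
    (φ : Matrix (Fin n) (Fin m) (MvPolynomial σ k)) (c : Fin n ↪ Fin m) {j : ℕ}
    {ω : Finset (Fin m) → MvPolynomial σ k} (hω : IsForm j ω)
    (hcyc : wedgeV (MvPolynomial σ k) (MvPolynomial σ k)
      (Matrix.vecMul (fun i => MvPolynomial.X (x i)) φ) ω = 0)
    (hωx : n ≤ j → ∀ I, ∀ d ∈ (ω I).support, ∃ a, d (x a) ≠ 0) :
    ∃ (s : ℕ) (η : Finset (Fin m) → MvPolynomial σ k),
      (φ.submatrix id c).det ^ s • ω =
        wedgeV (MvPolynomial σ k) (MvPolynomial σ k)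
          (Matrix.vecMul (fun i => MvPolynomial.X (x i)) φ) η := by
  have h := isCAR_minor (E := MvPolynomial σ k) φ c
  rw [wedgeV_vecMul, ← listD_finRange] at hcyc ⊢
  refine h.exists_pow_smul_eq_listD (List.nodup_finRange n)
    (fun a l ha g hg => mem_listX_of_X_smul_mem hx ha hg) hcyc ?_
  by_cases hj : n ≤ j
  · refine map_mem_listX _ (mem_listX_pi_iff.2 fun I d hd => ?_)
    obtain ⟨a, ha⟩ := hωx hj I d hd
    exact ⟨a, List.mem_finRange a, ha⟩
  · rw [listC_apply_eq_zero (fun k d ω hω => hω.contrV _) (fun k ω hω => hω.contrV_zero _) _ hω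
      (by rw [List.length_finRange]; omega)]
    exact zero_mem _

lemma listC_wedge_apply_eq_zero {R E κ : Type} [CommRing R] [AddCommGroup E] [Module R E]
    (f : κ → Fin r) (l : List κ) {d : ℕ} {ω : Finset (Fin r) → E} (hω : IsForm d ω)
    (hd : r < d + l.length) : listC (fun k => wedge R E (f k)) l ω = 0 := by
  induction l generalizing d ω with
  | nil => rw [hω.eq_zero_of_lt (by simpa using hd), map_zero]
  | cons a l ih =>
    rw [listC, Module.End.mul_apply]
    refine ih (hω.wedge (f a)) ?_
    rw [List.length_cons] at hd
    omega

/-- Contraction with a vector of variables is exact in positive exterior degrees. -/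
theorem exists_eq_contrV {x : Fin n → σ} (hx : Function.Injective x) {d : ℕ}
    {ρ : Finset (Fin n) → MvPolynomial σ k} (hρ : IsForm (d + 1) ρ)
    (hcyc : contrV (MvPolynomial σ k) _ (fun i => MvPolynomial.X (x i)) ρ = 0) :
    ∃ η, ρ = contrV (MvPolynomial σ k) _ (fun i => MvPolynomial.X (x i)) η := by
  rw [contrV, ← listD_finRange] at hcyc ⊢
  obtain ⟨s, η, h⟩ := isCAR_contr_wedge.exists_pow_smul_eq_listD (List.nodup_finRange n)
    (fun a l ha g hg => mem_listX_of_X_smul_mem hx ha hg) hcyc (by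
      rw [listC_wedge_apply_eq_zero (fun k => k) _ hρ (by rw [List.length_finRange]; omega)]
      exact zero_mem _)
  rw [one_pow, one_smul] at h
  exact ⟨η, h⟩

lemma contrV_coord {R ι : Type} [CommRing R] (a : Fin r → R) (ρ : Finset (Fin r) → ι → R)
    (I : Finset (Fin r)) (i : ι) :
    contrV R (ι → R) a ρ I i = contrV R R a (fun I => ρ I i) I := by
  simp only [contrV, LinearMap.sum_apply, Finset.sum_apply, LinearMap.smul_apply, Pi.smul_apply]
  refine Finset.sum_congr rfl fun j _ => ?_
  rw [contr_apply, contr_apply]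
  split_ifs <;> simp

/-- Contraction with a vector of variables on forms with coefficients in a free module is exact in
positive exterior degrees. -/
theorem exists_isForm_eq_contrV {ι : Type} {x : Fin n → σ} (hx : Function.Injective x) {d : ℕ}
    {ρ : Finset (Fin n) → ι → MvPolynomial σ k} (hρ : IsForm (d + 1) ρ)
    (hcyc : contrV (MvPolynomial σ k) _ (fun i => MvPolynomial.X (x i)) ρ = 0) :
    ∃ η, IsForm (d + 2) η ∧ ρ = contrV (MvPolynomial σ k) _ (fun i => MvPolynomial.X (x i)) η := by
  have h : ∀ i, ∃ η, (fun I => ρ I i) =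
      contrV (MvPolynomial σ k) _ (fun i => MvPolynomial.X (x i)) η := fun i => by
    refine exists_eq_contrV hx (fun I hI => congrFun (hρ I hI) i) ?_
    funext I
    rw [← contrV_coord, hcyc]
    rfl
  choose η hη using h
  refine ⟨formPart (MvPolynomial σ k) _ n (d + 2) fun I i => η i I, isForm_formPart _ _, ?_⟩
  rw [← formPart_contrV, ← hρ.formPart_eq (R := MvPolynomial σ k)]
  congr 1
  funext I i
  rw [contrV_coord, ← hη i]

end Regular

section Tower

open CategoryTheory Abelian

variable {R : Type} [CommRing R]

section Step

variable {A B C A' B' C' M : Type} [AddCommGroup A] [AddCommGroup B] [AddCommGroup C]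
  [AddCommGroup A'] [AddCommGroup B'] [AddCommGroup C'] [AddCommGroup M]
  [Module R A] [Module R B] [Module R C] [Module R A'] [Module R B'] [Module R C'] [Module R M]
  {f : A →ₗ[R] B} {g : B →ₗ[R] C} {f' : A' →ₗ[R] B'} {g' : B' →ₗ[R] C'}

lemma exists_extClass_comp_eq (h : Function.Exact f g) (hf : Function.Injective f)
    (hg : Function.Surjective g) {j : ℕ} (hB : ExtZero R B M (j + 1))
    (x : Ext (ModuleCat.of R C) (ModuleCat.of R M) (j + 1)) :
    ∃ y : Ext (ModuleCat.of R A) (ModuleCat.of R M) j,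
      (linShort_shortExact h hf hg).extClass.comp y (add_comm 1 j) = x :=
  Ext.contravariant_sequence_exact₃ (linShort_shortExact h hf hg) _ x (hB.elim _ _) (add_comm 1 j)

lemma exists_mk₀_comp_eq (h : Function.Exact f g) (hf : Function.Injective f)
    (hg : Function.Surjective g) {j : ℕ} {y : Ext (ModuleCat.of R A) (ModuleCat.of R M) j}
    (hy : (linShort_shortExact h hf hg).extClass.comp y (add_comm 1 j) = 0) :
    ∃ z : Ext (ModuleCat.of R B) (ModuleCat.of R M) j,
      (Ext.mk₀ (ModuleCat.ofHom f)).comp z (zero_add j) = y :=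
  Ext.contravariant_sequence_exact₁ (linShort_shortExact h hf hg) _ y (add_comm 1 j) hy

lemma mk₀_comp_extClass_comp (h : Function.Exact f g) (hf : Function.Injective f)
    (hg : Function.Surjective g) (h' : Function.Exact f' g') (hf' : Function.Injective f')
    (hg' : Function.Surjective g') {a : A →ₗ[R] A'} {b : B →ₗ[R] B'} {c : C →ₗ[R] C'}
    (hab : b ∘ₗ f = f' ∘ₗ a) (hbc : c ∘ₗ g = g' ∘ₗ b) {j : ℕ}
    (y : Ext (ModuleCat.of R A') (ModuleCat.of R M) j) :
    (Ext.mk₀ (ModuleCat.ofHom c)).comp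
        ((linShort_shortExact h' hf' hg').extClass.comp y (add_comm 1 j)) (zero_add (j + 1)) =
      (linShort_shortExact h hf hg).extClass.comp
        ((Ext.mk₀ (ModuleCat.ofHom a)).comp y (zero_add j)) (add_comm 1 j) := by
  let φ : linShort f g h ⟶ linShort f' g' h' :=
    { τ₁ := ModuleCat.ofHom a
      τ₂ := ModuleCat.ofHom b
      τ₃ := ModuleCat.ofHom c
      comm₁₂ := by rw [← ModuleCat.ofHom_comp, ← ModuleCat.ofHom_comp, hab]
      comm₂₃ := by rw [← ModuleCat.ofHom_comp, ← ModuleCat.ofHom_comp, hbc] }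
  have key := ShortComplex.ShortExact.extClass_naturality (linShort_shortExact h hf hg)
    (linShort_shortExact h' hf' hg') φ
  have h1 := Ext.comp_assoc (Ext.mk₀ φ.τ₃) (linShort_shortExact h' hf' hg').extClass y
    (zero_add 1) (add_comm 1 j) (by omega : 0 + 1 + j = j + 1)
  have h2 := Ext.comp_assoc (linShort_shortExact h hf hg).extClass (Ext.mk₀ φ.τ₁) y
    (add_zero 1) (zero_add j) (by omega : 1 + 0 + j = j + 1)
  rw [← key] at h1
  exact h1.symm.trans h2

end Step

variable {L L' : ℕ → Type} [∀ j, AddCommGroup (L j)] [∀ j, Module R (L j)]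
  [∀ j, AddCommGroup (L' j)] [∀ j, Module R (L' j)]

/-- The coboundaries of a sequence of maps. -/
def cob (d : ∀ j, L j →ₗ[R] L (j + 1)) : ∀ j, Submodule R (L j)
  | 0 => ⊥
  | j + 1 => LinearMap.range (d j)

/-- The cokernels of a sequence of maps. -/
abbrev Cok (d : ∀ j, L j →ₗ[R] L (j + 1)) (j : ℕ) : Type := L j ⧸ cob d j

variable {d : ∀ j, L j →ₗ[R] L (j + 1)} {d' : ∀ j, L' j →ₗ[R] L' (j + 1)}

lemma cob_le_ker (hd : ∀ j x, d (j + 1) (d j x) = 0) (j : ℕ) :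
    cob d j ≤ LinearMap.ker (d j) := by
  cases j with
  | zero => exact bot_le
  | succ j => rintro _ ⟨x, rfl⟩; exact hd j x

/-- The map induced by the differential on the cokernel of the previous one. -/
def dbar (hd : ∀ j x, d (j + 1) (d j x) = 0) (j : ℕ) : Cok d j →ₗ[R] L (j + 1) :=
  (cob d j).liftQ (d j) (cob_le_ker hd j)

variable (hd : ∀ j x, d (j + 1) (d j x) = 0) (hd' : ∀ j x, d' (j + 1) (d' j x) = 0)

lemma dbar_exact (j : ℕ) : Function.Exact (dbar hd j) (cob d (j + 1)).mkQ := by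
  intro y
  rw [Submodule.mkQ_apply, Submodule.Quotient.mk_eq_zero]
  constructor
  · rintro ⟨x, rfl⟩; exact ⟨Submodule.Quotient.mk x, rfl⟩
  · rintro ⟨x, rfl⟩
    obtain ⟨x, rfl⟩ := Submodule.Quotient.mk_surjective _ x
    exact ⟨x, rfl⟩

lemma dbar_injective_iff {j : ℕ} :
    Function.Injective (dbar hd j) ↔ ∀ x, d j x = 0 → x ∈ cob d j := by
  rw [injective_iff_map_eq_zero]
  constructor
  · intro h x hx
    exact (Submodule.Quotient.mk_eq_zero _).1 (h (Submodule.Quotient.mk x) hx)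
  · intro h x hx
    obtain ⟨x, rfl⟩ := Submodule.Quotient.mk_surjective _ x
    exact (Submodule.Quotient.mk_eq_zero _).2 (h x hx)

lemma cob_le_comap {α : ∀ j, L j →ₗ[R] L' j} (hα : ∀ j x, α (j + 1) (d j x) = d' j (α j x))
    (j : ℕ) : cob d j ≤ (cob d' j).comap (α j) := by
  cases j with
  | zero => exact bot_le
  | succ j => rintro _ ⟨x, rfl⟩; exact ⟨α j x, (hα j x).symm⟩

/-- The map induced by a chain map on cokernels. -/
def cokMap {α : ∀ j, L j →ₗ[R] L' j} (hα : ∀ j x, α (j + 1) (d j x) = d' j (α j x))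
    (j : ℕ) : Cok d j →ₗ[R] Cok d' j :=
  Submodule.mapQ _ _ (α j) (cob_le_comap hα j)

/-- The cokernels of an exact sequence with terms `L j` of projective dimension `< j + 1`
have the expected projective dimension. -/
lemma pdLT_cok {m : ℕ} (hinj : ∀ j < m, Function.Injective (dbar hd j))
    (hL : ∀ j ≤ m, PdLT R (L j) (j + 1)) : ∀ j ≤ m, PdLT R (Cok d j) (j + 1) := by
  intro j hj
  induction j with
  | zero => exact pdLT_of_equiv (Submodule.quotEquivOfEqBot _ rfl).symm (hL 0 hj)
  | succ j ih =>
    exact pdLT_right (dbar_exact hd j) (hinj j hj) (Submodule.mkQ_surjective _) (ih (by omega))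
      (hL (j + 1) hj)

/-- Acyclicity lemma: a complex with terms of small projective dimension is exact as soon as its
cohomology is supported on a set of large depth. -/
theorem dbar_injective [IsNoetherianRing R] [∀ j, Module.Finite R (L j)] {G : Set R} {m : ℕ}
    (hT : ∀ (T : Type) [AddCommGroup T] [Module R T] [Module.Finite R T],
      Module.support R T ⊆ PrimeSpectrum.zeroLocus G → ∀ a < m, ExtZero R T R a)
    (hL : ∀ j < m, PdLT R (L j) (j - 1 + 1))
    (hG : ∀ j < m, ∀ x, d j x = 0 → ∀ f ∈ G, ∃ s : ℕ, f ^ s • x ∈ cob d j) :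
    ∀ j < m, Function.Injective (dbar hd j) := by
  have key : ∀ j < m, (∀ i < j, Function.Injective (dbar hd i)) →
      Function.Injective (dbar hd j) := by
    intro j hj hinj
    set T := LinearMap.ker (dbar hd j) with hTdef
    have hTs : Module.support R T ⊆ PrimeSpectrum.zeroLocus G := by
      intro P hP f hf
      obtain ⟨⟨t, ht⟩, hPt⟩ := Module.mem_support_iff_exists_annihilator.1 hP
      obtain ⟨x, rfl⟩ := Submodule.Quotient.mk_surjective _ t
      obtain ⟨s, hs⟩ := hG j hj x ht f hf
      refine P.2.mem_of_pow_mem s (hPt ?_)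
      rw [Submodule.mem_annihilator_span_singleton]
      exact Subtype.ext ((Submodule.Quotient.mk_eq_zero _).2 hs)
    have hE : ∀ i ≤ j, ∀ a, a + i < m → ExtZero R T (Cok d i) a := by
      intro i hi
      induction i with
      | zero =>
        intro a ha
        exact ExtZero.of_equiv_right (Submodule.quotEquivOfEqBot _ rfl).symm
          (ExtZero.of_pdLT_right (hT T hTs) (hL 0 (by omega)) a ha)
      | succ i ih =>
        intro a ha
        exact ExtZero.cov_right (dbar_exact hd i) (hinj i hi) (Submodule.mkQ_surjective _)
          (ExtZero.of_pdLT_right (hT T hTs) (hL (i + 1) (by omega)) a (by omega))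
          (ih (by omega) (a + 1) (by omega))
    have h0 := (hE j le_rfl 0 (by omega)).linearMap_eq_zero T.subtype
    rw [injective_iff_map_eq_zero]
    intro x hx
    exact LinearMap.congr_fun h0 ⟨x, hx⟩
  intro j
  induction j using Nat.strong_induction_on with
  | _ j ih => exact fun hj => key j hj fun i hi => ih i hi (hi.trans hj)

/-- Computation of the annihilator of a generator of `Ext^j(Cok d j, R)` by comparison with a
second complex. -/
theorem exists_ext_generator {m N : ℕ} {Z I : Ideal R}
    (hinj : ∀ j < m, Function.Injective (dbar hd j))
    (hinj' : ∀ j < N, Function.Injective (dbar hd' j))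
    (hL : ∀ j ≤ N, PdLT R (L j) 1) (hL₂ : ∀ j, N < j → PdLT R (L j) (N + 1))
    (hL' : ∀ j, PdLT R (L' j) 1)
    {α : ∀ j, L j →ₗ[R] L' j} (hα : ∀ j x, α (j + 1) (d j x) = d' j (α j x))
    (ev : L 0 ≃ₗ[R] R)
    (hZ : 0 < N → ∀ h : L 1 →ₗ[R] R, h (d 0 (ev.symm 1)) ∈ Z)
    (hI : ∀ h : L' 0 →ₗ[R] R, h (α 0 (ev.symm 1)) ∈ I)
    {β : L' N →ₗ[R] L (N + 1)} (hβ : ∀ x ∈ cob d' N, β x = 0) (hβα : ∀ x, β (α N x) = d N x) :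
    ∀ j ≤ m, ∃ c : Ext (ModuleCat.of R (Cok d j)) (ModuleCat.of R R) j,
      (∀ x, ∃ f : R, x = f • c) ∧ (∀ f : R, f • c = 0 → f ∈ Z ⊔ I) ∧
      (j ≤ N → ∀ f : R, f • c = 0 → f ∈ Z) ∧
      (j < N → ∀ (f : R) (h : Ext (ModuleCat.of R (L (j + 1))) (ModuleCat.of R R) j),
        (Ext.mk₀ (ModuleCat.ofHom (dbar hd j))).comp h (zero_add j) = f • c → f ∈ Z) ∧
      (j ≤ N → ∀ h : Ext (ModuleCat.of R (Cok d' j)) (ModuleCat.of R R) j, ∃ δ ∈ I,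
        (Ext.mk₀ (ModuleCat.ofHom (cokMap hα j))).comp h (zero_add j) = δ • c) := by
  intro j hj
  induction j with
  | zero =>
    let ev₀ : Cok d 0 ≃ₗ[R] R := (Submodule.quotEquivOfEqBot _ rfl).trans ev
    have hev : ev₀ (Submodule.Quotient.mk (ev.symm 1)) = 1 := ev.apply_symm_apply 1
    have hev' : ev₀.symm 1 = Submodule.Quotient.mk (ev.symm 1) := by
      rw [LinearEquiv.symm_apply_eq, hev]
    have hgen : ∀ g : Cok d 0 →ₗ[R] R, g = g (Submodule.Quotient.mk (ev.symm 1)) •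
        ev₀.toLinearMap := by
      intro g
      refine LinearMap.ext fun y => ?_
      obtain ⟨r, rfl⟩ := ev₀.symm.surjective y
      rw [LinearMap.smul_apply, LinearEquiv.coe_coe, LinearEquiv.apply_symm_apply, ← hev',
        smul_eq_mul, mul_comm, ← smul_eq_mul, ← map_smul, ← map_smul, smul_eq_mul, mul_one]
    have hmk : ∀ (f : R) (g : Cok d 0 →ₗ[R] R), f • Ext.mk₀ (ModuleCat.ofHom g) =
        Ext.mk₀ (ModuleCat.ofHom (f • g)) := fun f g => (Ext.mk₀_smul _ _).symm
    have heq : ∀ (f : R) (g : Cok d 0 →ₗ[R] R), Ext.mk₀ (ModuleCat.ofHom g) =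
        f • Ext.mk₀ (ModuleCat.ofHom ev₀.toLinearMap) →
          f = g (Submodule.Quotient.mk (ev.symm 1)) := by
      intro f g h
      rw [hmk, (Ext.mk₀_bijective _ _).1.eq_iff] at h
      have h1 := LinearMap.congr_fun (congrArg ModuleCat.Hom.hom h)
        (Submodule.Quotient.mk (ev.symm 1))
      simp only [ModuleCat.hom_ofHom, LinearMap.smul_apply, LinearEquiv.coe_coe, hev,
        smul_eq_mul, mul_one] at h1
      exact h1.symm
    have hzero : ∀ f : R, f • Ext.mk₀ (ModuleCat.ofHom ev₀.toLinearMap) = 0 → f = 0 := by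
      intro f hf
      refine heq f 0 ?_
      rw [hf, Ext.mk₀_eq_zero_iff]
      rfl
    refine ⟨Ext.mk₀ (ModuleCat.ofHom ev₀.toLinearMap), fun x => ?_, fun f hf => ?_,
      fun _ f hf => ?_, fun hN f h hf => ?_, fun _ h => ?_⟩
    · obtain ⟨y, rfl⟩ := (Ext.mk₀_bijective _ _).2 x
      refine ⟨y.hom (Submodule.Quotient.mk (ev.symm 1)), ?_⟩
      rw [hmk, ← hgen]
      rfl
    · rw [hzero f hf]; exact zero_mem _
    · rw [hzero f hf]; exact zero_mem _
    · obtain ⟨y, rfl⟩ := (Ext.mk₀_bijective _ _).2 h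
      rw [Ext.mk₀_comp_mk₀] at hf
      rw [heq f (y.hom ∘ₗ dbar hd 0) hf]
      exact hZ hN y.hom
    · obtain ⟨y, rfl⟩ := (Ext.mk₀_bijective _ _).2 h
      refine ⟨y.hom (Submodule.Quotient.mk (α 0 (ev.symm 1))),
        hI (y.hom ∘ₗ (cob d' 0).mkQ), ?_⟩
      rw [Ext.mk₀_comp_mk₀, hmk]
      exact congrArg (fun g => Ext.mk₀ (ModuleCat.ofHom g)) (hgen (y.hom ∘ₗ cokMap hα 0))
  | succ j ih =>
    obtain ⟨c, hc, hcJ, hcZ, hcZ', hcI⟩ := ih (by omega)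
    have hses := linShort_shortExact (dbar_exact hd j) (hinj j hj) (Submodule.mkQ_surjective _)
    have hE : ExtZero R (L (j + 1)) R (j + 1) := by
      by_cases h : j + 1 ≤ N
      · exact ExtZero.of_pdLT (hL _ h) (by omega)
      · exact ExtZero.of_pdLT (hL₂ (j + 1) (by omega)) (by omega)
    have hker : ∀ f : R, f • hses.extClass.comp c (add_comm 1 j) = 0 →
        ∃ z : Ext (ModuleCat.of R (L (j + 1))) (ModuleCat.of R R) j,
          (Ext.mk₀ (ModuleCat.ofHom (dbar hd j))).comp z (zero_add j) = f • c := by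
      intro f hf
      rw [← Ext.comp_smul] at hf
      exact exists_mk₀_comp_eq (dbar_exact hd j) (hinj j hj) (Submodule.mkQ_surjective _) hf
    have hZ' : j + 1 ≤ N → ∀ f : R, f • hses.extClass.comp c (add_comm 1 j) = 0 → f ∈ Z := by
      intro hjN f hf
      obtain ⟨z, hz⟩ := hker f hf
      exact hcZ' hjN f z hz
    refine ⟨hses.extClass.comp c (add_comm 1 j), ?_, ?_, hZ', ?_, ?_⟩
    · intro x
      obtain ⟨y, rfl⟩ := exists_extClass_comp_eq (dbar_exact hd j) (hinj j hj)
        (Submodule.mkQ_surjective _) hE x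
      obtain ⟨f, rfl⟩ := hc y
      exact ⟨f, Ext.comp_smul _ _ _ _⟩
    · intro f hf
      by_cases hjN : j + 1 ≤ N
      · exact Ideal.mem_sup_left (hZ' hjN f hf)
      obtain ⟨z, hz⟩ := hker f hf
      rcases (show N ≤ j by omega).eq_or_lt with rfl | hj'
      · let βb : Cok d' N →ₗ[R] L (N + 1) := (cob d' N).liftQ β hβ
        have hfac : dbar hd N = βb ∘ₗ cokMap hα N := by
          refine LinearMap.ext fun x => ?_
          obtain ⟨x, rfl⟩ := Submodule.Quotient.mk_surjective _ x
          exact (hβα x).symm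
        obtain ⟨δ, hδ, hy⟩ := hcI le_rfl ((Ext.mk₀ (ModuleCat.ofHom βb)).comp z (zero_add N))
        rw [Ext.mk₀_comp_mk₀_assoc, ← ModuleCat.ofHom_comp, ← hfac, hz] at hy
        have h0 : (f - δ) • c = 0 := by rw [sub_smul, hy, sub_self]
        rw [← sub_add_cancel f δ]
        exact add_mem (Ideal.mem_sup_left (hcZ le_rfl _ h0)) (Ideal.mem_sup_right hδ)
      · refine hcJ f ?_
        rw [← hz, (ExtZero.of_pdLT (hL₂ (j + 1) (by omega)) hj').elim z 0, Ext.comp_zero]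
    · intro hjN f h hf
      rw [(ExtZero.of_pdLT (hL (j + 1 + 1) hjN) (by omega)).elim h 0, Ext.comp_zero] at hf
      exact hZ' (by omega) f hf.symm
    · intro hjN h
      obtain ⟨y, rfl⟩ := exists_extClass_comp_eq (dbar_exact hd' j) (hinj' j hjN)
        (Submodule.mkQ_surjective _) (ExtZero.of_pdLT (hL' (j + 1)) (by omega)) h
      obtain ⟨δ, hδ, hy⟩ := hcI (by omega) y
      refine ⟨δ, hδ, ?_⟩
      rw [mk₀_comp_extClass_comp (dbar_exact hd j) (hinj j hj) (Submodule.mkQ_surjective _)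
        (dbar_exact hd' j) (hinj' j hjN) (Submodule.mkQ_surjective _) (a := cokMap hα j)
        (b := α (j + 1)) (c := cokMap hα (j + 1)), hy, Ext.comp_smul]
      · refine LinearMap.ext fun x => ?_
        obtain ⟨x, rfl⟩ := Submodule.Quotient.mk_surjective _ x
        exact hα j x
      · rfl

end Tower

section Minors

variable {R : Type} [CommRing R] {n m : ℕ}

lemma wedgeV_apply {E : Type} [AddCommGroup E] [Module R E] (a : Fin m → R)
    (ω : Finset (Fin m) → E) (I : Finset (Fin m)) :
    wedgeV R E a ω I = ∑ j ∈ I, (a j * ksign R j I) • ω (I.erase j) := by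
  simp only [wedgeV, LinearMap.sum_apply, Finset.sum_apply, LinearMap.smul_apply, Pi.smul_apply,
    wedge_apply, smul_ite, smul_zero, smul_smul]
  rw [← Finset.sum_filter]
  simp

lemma contrV_apply {E : Type} [AddCommGroup E] [Module R E] (a : Fin m → R)
    (ω : Finset (Fin m) → E) (I : Finset (Fin m)) :
    contrV R E a ω I = ∑ j ∈ Iᶜ, (a j * ksign R j I) • ω (insert j I) := by
  simp only [contrV, LinearMap.sum_apply, Finset.sum_apply, LinearMap.smul_apply, Pi.smul_apply,
    contr_apply, smul_ite, smul_zero, smul_smul, Finset.compl_eq_univ_sdiff]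
  rw [Finset.sum_ite, Finset.sum_const_zero, zero_add]
  congr 1
  ext; simp

lemma contrV_congr {E : Type} [AddCommGroup E] [Module R E] (a : Fin m → R)
    {ω ω' : Finset (Fin m) → E} {I : Finset (Fin m)}
    (h : ∀ J : Finset (Fin m), J.card = I.card + 1 → ω J = ω' J) :
    contrV R E a ω I = contrV R E a ω' I := by
  rw [contrV_apply, contrV_apply]
  refine Finset.sum_congr rfl fun j hj => ?_
  rw [h _ (Finset.card_insert_of_notMem (Finset.mem_compl.1 hj))]

/-- Exterior multiplication, as a linear map in the vector. -/
def wedgeL (R : Type) [CommRing R] (m : ℕ) :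
    (Fin m → R) →ₗ[R] Module.End R (Finset (Fin m) → R) where
  toFun a := wedgeV R R a
  map_add' a b := by simp [wedgeV, add_smul, Finset.sum_add_distrib]
  map_smul' c a := by simp [wedgeV, mul_smul, Finset.smul_sum]

/-- The alternating map sending `v` to the product of the exterior multiplications by `v i`. -/
noncomputable def wedgeAlt (R : Type) [CommRing R] (n m : ℕ) :
    (Fin m → R) [⋀^Fin n]→ₗ[R] Module.End R (Finset (Fin m) → R) :=
  (ExteriorAlgebra.lift R ⟨wedgeL R m, fun a => wedgeV_mul_self a⟩).toLinearMap.compAlternatingMap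
    (ExteriorAlgebra.ιMulti R n)

lemma wedgeAlt_apply (v : Fin n → Fin m → R) :
    wedgeAlt R n m v = ((List.finRange n).map fun i => wedgeV R R (v i)).prod := by
  rw [wedgeAlt, LinearMap.compAlternatingMap_apply, ExteriorAlgebra.ιMulti_apply,
    AlgHom.toLinearMap_apply, map_list_prod, List.map_ofFn, List.ofFn_eq_map]
  congr 2
  funext i
  simp [wedgeL]
  rfl

lemma prod_wedgeV_congr {ι : Type} (l : List ι) {v v' : ι → Fin m → R} {J : Finset (Fin m)}
    (h : ∀ i, ∀ j ∈ J, v i j = v' i j) (ω : Finset (Fin m) → R) :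
    ∀ I ⊆ J, (l.map fun i => wedgeV R R (v i)).prod ω I =
      (l.map fun i => wedgeV R R (v' i)).prod ω I := by
  induction l with
  | nil => simp
  | cons a l ih =>
    intro I hI
    rw [List.map_cons, List.map_cons, List.prod_cons, List.prod_cons, Module.End.mul_apply,
      Module.End.mul_apply, wedgeV_apply, wedgeV_apply]
    refine Finset.sum_congr rfl fun j hj => ?_
    rw [h a j (hI hj), ih _ ((Finset.erase_subset _ _).trans hI)]

lemma isForm_prod_wedgeV {ι : Type} (l : List ι) (v : ι → Fin m → R) {d : ℕ}
    {ω : Finset (Fin m) → R} (hω : IsForm d ω) :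
    IsForm (d + l.length) ((l.map fun i => wedgeV R R (v i)).prod ω) := by
  induction l with
  | nil => simpa using hω
  | cons a l ih =>
    rw [List.map_cons, List.prod_cons, Module.End.mul_apply, List.length_cons, ← add_assoc]
    exact ih.wedgeV _

/-- The coefficients of the exterior product of the rows of `φ` are multiples of maximal minors. -/
lemma prod_wedgeV_mem (φ : Matrix (Fin n) (Fin m) R) {A : Ideal R}
    (hA : ∀ c : Fin n ↪ Fin m, (φ.submatrix id c).det ∈ A) {ω : Finset (Fin m) → R}
    (hω : IsForm 0 ω) (J : Finset (Fin m)) :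
    ((List.finRange n).map fun i => wedgeV R R (φ i)).prod ω J ∈ A := by
  by_cases hJ : J.card = n
  swap
  · have h0 := isForm_prod_wedgeV (List.finRange n) (fun i => φ i) hω J (by simpa using hJ)
    exact (congrArg (· ∈ A) h0).mpr (zero_mem _)
  let c : Fin n ↪ Fin m := (J.orderEmbOfFin hJ).toEmbedding
  have hc : ∀ b, c b ∈ J := fun b => Finset.orderEmbOfFin_mem J hJ b
  have hc' : ∀ j ∈ J, ∃ b, c b = j := fun j hj => by
    have : j ∈ Set.range (J.orderEmbOfFin hJ) := by rw [Finset.range_orderEmbOfFin]; exact hj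
    exact this
  let ext : (Fin n → R) →ₗ[R] (Fin m → R) :=
    { toFun := fun u j => ∑ b, if c b = j then u b else 0
      map_add' := fun u w => by
        funext j
        simp [← Finset.sum_add_distrib, ite_add_ite]
      map_smul' := fun r u => by
        funext j
        simp [Finset.mul_sum] }
  let ev : Module.End R (Finset (Fin m) → R) →ₗ[R] R :=
    LinearMap.proj J ∘ₗ LinearMap.applyₗ ω
  let G : (Fin n → R) [⋀^Fin n]→ₗ[R] R :=
    (ev.compAlternatingMap (wedgeAlt R n m)).compLinearMap ext
  have hG : ((List.finRange n).map fun i => wedgeV R R (φ i)).prod ω J =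
      G (φ.submatrix id c) := by
    change _ = (wedgeAlt R n m fun i => ext (φ.submatrix id c i)) ω J
    rw [wedgeAlt_apply]
    refine prod_wedgeV_congr _ (J := J) (fun i j hj => ?_) ω J subset_rfl
    obtain ⟨b, rfl⟩ := hc' j hj
    simp [ext]
  have hdet := DFunLike.congr_fun (G.eq_smul_basis_det (Pi.basisFun R (Fin n)))
    (φ.submatrix id c)
  rw [Pi.basisFun_det] at hdet
  exact (congrArg (· ∈ A) (hG.trans hdet)).mpr (A.mul_mem_left _ (hA c))

end Minors

section Comparison

lemma mul_one_add_mul_of_anticomm {A : Type} [Ring A] {t w s : A} (h : t * w = -(w * t))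
    (h' : t * s = -(s * t)) : t * (1 + w * s) = (1 + w * s) * t := by
  rw [mul_add, add_mul, mul_one, one_mul, ← mul_assoc, h, neg_mul, mul_assoc, h', mul_neg,
    neg_neg, mul_assoc]

lemma mul_one_add_mul_of_car {A : Type} [Ring A] {c w t u y : A} (h : c * w = u - w * c)
    (hy : u * t = y) (hty : t * y = 0) (hct : c * t = -(t * c)) :
    c * (1 + w * t) = (1 + w * t) * (c + y) := by
  rw [mul_add, ← mul_assoc, h, sub_mul, hy, mul_assoc w c t, hct, add_mul, mul_add (w * t),
    mul_assoc w t y, hty]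
  noncomm_ring

variable {R E : Type} [CommRing R] [AddCommGroup E] [Module R E] {n : ℕ}

/-- The coefficientwise action of `f`, twisted by the parity of the exterior degree. -/
def twist (n : ℕ) (f : Module.End R E) : Module.End R (Finset (Fin n) → E) where
  toFun ω I := (-1 : R) ^ I.card • f (ω I)
  map_add' ω ω' := by funext I; simp
  map_smul' c ω := by funext I; simp [smul_comm c]

lemma twist_apply (f : Module.End R E) (ω : Finset (Fin n) → E) (I : Finset (Fin n)) :
    twist n f ω I = (-1 : R) ^ I.card • f (ω I) := rfl

lemma twist_mul_twist {f g : Module.End R E} (h : f * g = -(g * f)) :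
    twist n f * twist n g = -(twist n g * twist n f) := by
  refine LinearMap.ext fun ω => ?_
  funext I
  simp only [Module.End.mul_apply, twist_apply, LinearMap.neg_apply, Pi.neg_apply, map_smul]
  rw [← smul_neg, ← smul_neg, ← Module.End.mul_apply f g, h, LinearMap.neg_apply,
    Module.End.mul_apply]

lemma twist_mul_self {f : Module.End R E} (h : f * f = 0) : twist n f * twist n f = 0 := by
  refine LinearMap.ext fun ω => ?_
  funext I
  simp only [Module.End.mul_apply, twist_apply, map_smul]
  rw [← Module.End.mul_apply f f, h]
  simp

lemma twist_mul_wedge (f : Module.End R E) (j : Fin n) :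
    twist n f * wedge R E j = -(wedge R E j * twist n f) := by
  refine LinearMap.ext fun ω => ?_
  funext I
  simp only [Module.End.mul_apply, twist_apply, wedge_apply, LinearMap.neg_apply, Pi.neg_apply]
  split_ifs with hj
  · rw [← Finset.insert_erase hj, Finset.card_insert_of_notMem (Finset.notMem_erase _ _),
      Finset.insert_erase hj, map_smul, pow_succ]
    module
  · simp

lemma twist_mul_contr (f : Module.End R E) (j : Fin n) :
    twist n f * contr R E j = -(contr R E j * twist n f) := by
  refine LinearMap.ext fun ω => ?_
  funext I
  simp only [Module.End.mul_apply, twist_apply, contr_apply, LinearMap.neg_apply, Pi.neg_apply]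
  split_ifs with hj
  · simp
  · rw [Finset.card_insert_of_notMem hj, map_smul, pow_succ]
    module

lemma twist_mul_contrV (f : Module.End R E) (x : Fin n → R) :
    twist n f * contrV R E x = -(contrV R E x * twist n f) := by
  rw [contrV, Finset.mul_sum, Finset.sum_mul, ← Finset.sum_neg_distrib]
  simp only [mul_smul_comm, smul_mul_assoc, twist_mul_contr, smul_neg]

lemma contrV_mul_wedge (x : Fin n → R) (j : Fin n) :
    contrV R E x * wedge R E j = x j • 1 - wedge R E j * contrV R E x := by
  have := wedgeV_mul_contrV (E := E) (Pi.single j (1 : R)) x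
  have h : wedgeV R E (Pi.single j (1 : R)) = wedge R E j := by
    rw [wedgeV, Finset.sum_eq_single j] <;> simp +contextual
  rw [h, single_one_dotProduct] at this
  rw [← this]
  abel

/-- The product of the operators `1 + wedge k * twist (e k)`. -/
def compOp (e : Fin n → Module.End R E) (l : List (Fin n)) :
    Module.End R (Finset (Fin n) → E) :=
  (l.map fun k => 1 + wedge R E k * twist n (e k)).prod

/-- The inclusion of `E` in exterior degree zero. -/
def vac (R E : Type) [CommRing R] [AddCommGroup E] [Module R E] (n : ℕ) :
    E →ₗ[R] (Finset (Fin n) → E) := LinearMap.single R (fun _ => E) ∅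

variable {e : Fin n → Module.End R E} 

lemma contrV_mul_compOp (hee : ∀ i j, e i * e j = -(e j * e i)) (he : ∀ i, e i * e i = 0)
    (x : Fin n → R) (l : List (Fin n)) :
    contrV R E x * compOp e l =
      compOp e l * (contrV R E x + (l.map fun k => x k • twist n (e k)).sum) := by
  have hcomm : ∀ j k, twist n (e j) * (1 + wedge R E k * twist n (e k)) =
      (1 + wedge R E k * twist n (e k)) * twist n (e j) := by
    intro j k
    exact mul_one_add_mul_of_anticomm (twist_mul_wedge _ _) (twist_mul_twist (hee j k))
  induction l with
  | nil => simp [compOp]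
  | cons a l ih =>
    have h1 : contrV R E x * (1 + wedge R E a * twist n (e a)) =
        (1 + wedge R E a * twist n (e a)) * (contrV R E x + x a • twist n (e a)) := by
      have h2 : contrV R E x * twist n (e a) = -(twist n (e a) * contrV R E x) := by
        rw [twist_mul_contrV, neg_neg]
      refine mul_one_add_mul_of_car (contrV_mul_wedge x a) (smul_one_mul _ _) ?_ h2
      rw [mul_smul_comm, twist_mul_self (he a), smul_zero]
    have h4 : (twist n (e a)) * compOp e l = compOp e l * twist n (e a) := by
      rw [compOp]
      refine Commute.list_prod_right _ _ fun y hy => ?_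
      obtain ⟨k, -, rfl⟩ := List.mem_map.1 hy
      exact hcomm a k
    have h5 : compOp e (a :: l) = (1 + wedge R E a * twist n (e a)) * compOp e l := by
      simp [compOp]
    have h6 : (contrV R E x + x a • twist n (e a)) * compOp e l = compOp e l *
        (contrV R E x + ((a :: l).map fun k => x k • twist n (e k)).sum) := by
      rw [add_mul, ih, smul_mul_assoc, h4, ← mul_smul_comm, ← mul_add, List.map_cons,
        List.sum_cons, add_assoc, add_comm (List.sum _)]
    rw [h5, ← mul_assoc, h1, mul_assoc, h6, mul_assoc]

lemma contrV_vac (x : Fin n → R) (v : E) : contrV R E x (vac R E n v) = 0 := by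
  funext I
  rw [contrV_apply]
  refine Finset.sum_eq_zero fun j _ => ?_
  simp [vac]

lemma twist_vac (f : Module.End R E) (v : E) : twist n f (vac R E n v) = vac R E n (f v) := by
  funext I
  rw [twist_apply]
  by_cases h : I = ∅
  · subst h; simp [vac]
  · simp [vac, h]

lemma contrV_compOp_vac (hee : ∀ i j, e i * e j = -(e j * e i)) (he : ∀ i, e i * e i = 0)
    (x : Fin n → R) (v : E) :
    contrV R E x (compOp e (List.finRange n) (vac R E n v)) =
      compOp e (List.finRange n) (vac R E n ((∑ k, x k • e k) v)) := by
  rw [← Module.End.mul_apply, contrV_mul_compOp hee he, Module.End.mul_apply,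
    LinearMap.add_apply, contrV_vac, zero_add, ← Fin.sum_univ_def, LinearMap.sum_apply,
    LinearMap.sum_apply, map_sum]
  simp [twist_vac]

lemma compOp_apply_empty (l : List (Fin n)) (ω : Finset (Fin n) → E) :
    compOp e l ω ∅ = ω ∅ := by
  induction l with
  | nil => simp [compOp]
  | cons a l ih =>
    rw [← ih]
    simp [compOp, wedge_apply]

lemma compOp_vac_top (l : List (Fin n)) (hl : l.Nodup) (v : E) :
    (∀ I, ¬ I ⊆ l.toFinset → compOp e l (vac R E n v) I = 0) ∧
      ∃ u : R, compOp e l (vac R E n v) l.toFinset = u • (l.map e).prod v := by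
  induction l with
  | nil =>
    refine ⟨fun I hI => ?_, 1, by simp [compOp, vac]⟩
    have : I ≠ ∅ := by rintro rfl; simp at hI
    simp [compOp, vac, this]
  | cons a l ih =>
    rw [List.nodup_cons] at hl
    obtain ⟨h1, u, hu⟩ := ih hl.2
    have h5 : ∀ I, compOp e (a :: l) (vac R E n v) I = compOp e l (vac R E n v) I +
        wedge R E a (twist n (e a) (compOp e l (vac R E n v))) I := fun I => by
      simp [compOp]
    rw [List.toFinset_cons]
    constructor
    · intro I hI
      rw [h5, h1 I fun h => hI (h.trans (Finset.subset_insert _ _)), zero_add, wedge_apply]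
      split_ifs with ha
      · rw [twist_apply, h1, map_zero, smul_zero, smul_zero]
        exact fun h => hI (by rw [← Finset.insert_erase ha]; exact Finset.insert_subset_insert _ h)
      · rfl
    · have ha : a ∉ l.toFinset := by simpa using hl.1
      refine ⟨ksign R a (insert a l.toFinset) * (-1) ^ l.toFinset.card * u, ?_⟩
      rw [h5, h1 _ fun h => ha (h (Finset.mem_insert_self _ _)), zero_add, wedge_apply,
        if_pos (Finset.mem_insert_self _ _), Finset.erase_insert ha, twist_apply, hu, map_smul,
        smul_smul, smul_smul, List.map_cons, List.prod_cons, Module.End.mul_apply, mul_assoc]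

end Comparison

section SuppOn

variable {R ι E : Type} [CommRing R] [AddCommGroup E] [Module R E] {P : ι → Prop}
  {N : Submodule R E}

/-- The functions with values in `N` which vanish outside of `P`. -/
def suppOn (P : ι → Prop) (N : Submodule R E) : Submodule R (ι → E) where
  carrier := {ω | ∀ I, ω I ∈ N ∧ (¬ P I → ω I = 0)}
  add_mem' h h' I := ⟨N.add_mem (h I).1 (h' I).1, fun hI => by
    rw [Pi.add_apply, (h I).2 hI, (h' I).2 hI, add_zero]⟩
  zero_mem' _ := ⟨N.zero_mem, fun _ => rfl⟩
  smul_mem' c _ h I := ⟨N.smul_mem c (h I).1, fun hI => by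
    rw [Pi.smul_apply, (h I).2 hI, smul_zero]⟩

open Classical in
/-- Functions supported on `P` are functions on the subtype. -/
noncomputable def suppOnEquiv (P : ι → Prop) (N : Submodule R E) : suppOn P N ≃ₗ[R] ({I // P I} → N) where
  toFun ω I := ⟨ω.1 I, (ω.2 I).1⟩
  map_add' _ _ := rfl
  map_smul' _ _ := rfl
  invFun f := ⟨fun I => if h : P I then (f ⟨I, h⟩ : E) else 0, fun I => by
    by_cases h : P I
    · simp [h]
    · simp [h]⟩
  left_inv ω := by
    refine Subtype.ext (funext fun I => ?_)
    by_cases h : P I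
    · simp [h]
    · simp [h, (ω.2 I).2 h]
  right_inv f := by
    funext I
    refine Subtype.ext ?_
    simp [I.2]

lemma pdLT_suppOn [Finite ι] {a : ℕ} (h : PdLT R N a) : PdLT R (suppOn P N) a :=
  pdLT_of_equiv (suppOnEquiv P N).symm (pdLT_pi_fintype h)

open Classical in
/-- The projection onto the functions supported on `P`. -/
noncomputable def suppProj (R E : Type) [CommRing R] [AddCommGroup E] [Module R E] (P : ι → Prop) :
    (ι → E) →ₗ[R] suppOn P (⊤ : Submodule R E) where
  toFun ω := ⟨fun I => if P I then ω I else 0, fun I => ⟨trivial, fun h => if_neg h⟩⟩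
  map_add' ω ω' := by
    refine Subtype.ext (funext fun I => ?_)
    by_cases h : P I <;> simp [h]
  map_smul' c ω := by
    refine Subtype.ext (funext fun I => ?_)
    by_cases h : P I <;> simp [h]

lemma suppProj_apply_of {I : ι} (h : P I) (ω : ι → E) : (suppProj R E P ω).1 I = ω I := if_pos h

lemma suppProj_coe (ω : suppOn P (⊤ : Submodule R E)) : suppProj R E P ω.1 = ω := by
  refine Subtype.ext (funext fun I => ?_)
  by_cases h : P I
  · exact if_pos h
  · rw [(ω.2 I).2 h]; exact if_neg h

lemma map_mem_of_forall_mem_smul_top [Finite ι] {A : Ideal R} (hN : N = ⊤) (g : suppOn P N)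
    (hg : ∀ I, g.1 I ∈ A • (⊤ : Submodule R E)) (h : suppOn P N →ₗ[R] R) : h g ∈ A := by
  classical
  subst hN
  cases nonempty_fintype ι
  have h1 : g = ∑ I, suppProj R E P (LinearMap.single R (fun _ => E) I (g.1 I)) := by
    simp only [← map_sum, LinearMap.coe_single, Finset.univ_sum_single, suppProj_coe]
  rw [h1, map_sum]
  refine sum_mem fun I _ => ?_
  have h2 := Submodule.mem_map_of_mem (f := h ∘ₗ suppProj R E P ∘ₗ
    LinearMap.single R (fun _ => E) I) (hg I)
  rw [Submodule.map_smul''] at h2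
  exact Ideal.mul_le_left (J := ⊤) (Submodule.smul_mono le_rfl le_top h2)

end SuppOn

section MinorsIdeal

variable {R : Type} [CommRing R] {n m : ℕ} {φ : Matrix (Fin n) (Fin m) R}

lemma det_mem_minorsIdeal (c : Fin n ↪ Fin m) : (φ.submatrix id c).det ∈ minorsIdeal n φ :=
  Ideal.subset_span ⟨Function.Embedding.refl _, c, rfl⟩

lemma minorsIdeal_le {A : Ideal R} (h : ∀ c : Fin n ↪ Fin m, (φ.submatrix id c).det ∈ A) :
    minorsIdeal n φ ≤ A := by
  refine Ideal.span_le.2 ?_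
  rintro _ ⟨r, c, rfl⟩
  have hr : Function.Bijective r := Finite.injective_iff_bijective.1 r.injective
  have h1 : φ.submatrix r c = (φ.submatrix id c).submatrix (Equiv.ofBijective r hr) id := rfl
  rw [h1, Matrix.det_permute]
  exact A.mul_mem_left _ (h c)

end MinorsIdeal

section Wedge

variable {R E : Type} [CommRing R] [AddCommGroup E] [Module R E] {n m : ℕ}

lemma smul_eq_wedgeV_contr (a : Fin m → R) (i : Fin m) {ω : Finset (Fin m) → E}
    (h : wedgeV R E a ω = 0) : a i • ω = wedgeV R E a (contr R E i ω) := by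
  have h1 : contrV R E (Pi.single i (1 : R)) = contr R E i := by
    rw [contrV, Finset.sum_eq_single i] <;> simp +contextual
  have h2 := congrArg (· ω) (wedgeV_mul_contrV (E := E) a (Pi.single i (1 : R)))
  simp only [LinearMap.add_apply, Module.End.mul_apply, h, map_zero, add_zero, h1,
    dotProduct_single, mul_one, LinearMap.smul_apply, Module.End.one_apply] at h2
  exact h2.symm

end Wedge

section Complexes

variable {k σ : Type} [Field k] [DecidableEq σ] {n m : ℕ}

/-- The weight counting the variables in the image of `x`. -/
def countWt (x : Fin n ↪ σ) (i : σ) : ℕ := if i ∈ Finset.univ.map x then 1 else 0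

lemma countWt_apply (x : Fin n ↪ σ) (a : Fin n) : countWt x (x a) = 1 := if_pos (by simp)

lemma exists_ne_zero_of_weight_countWt_ne_zero {x : Fin n ↪ σ} {d : σ →₀ ℕ}
    (h : Finsupp.weight (countWt x) d ≠ 0) : ∃ a, d (x a) ≠ 0 := by
  by_contra! h'
  refine h ?_
  rw [Finsupp.weight_apply]
  refine Finset.sum_eq_zero fun i _ => ?_
  by_cases hi : i ∈ Finset.univ.map x
  · obtain ⟨a, -, rfl⟩ := Finset.mem_map.1 hi
    simp [h' a]
  · simp [countWt, hi]

lemma pdLT_degGE_countWt (x : Fin n ↪ σ) (hn : 0 < n) (e : ℕ) :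
    PdLT (MvPolynomial σ k) (degGE (countWt x) e : Ideal (MvPolynomial σ k)) n := by
  have h := pdLT_degGE (k := k) (Finset.univ.map x) (by
    simpa using ⟨⟨0, hn⟩, Finset.mem_univ (⟨0, hn⟩ : Fin n)⟩) e
  rwa [Finset.card_map, Finset.card_univ, Fintype.card_fin] at h

variable (x : Fin n ↪ σ) (φ : Matrix (Fin n) (Fin m) (MvPolynomial σ k))

/-- The variables selected by `x`. -/
noncomputable def xVec (k : Type) [Field k] (x : Fin n ↪ σ) : Fin n → MvPolynomial σ k :=
  fun i => X (x i)

/-- The entries of `x φ`. -/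
noncomputable def zVec : Fin m → MvPolynomial σ k := Matrix.vecMul (xVec k x) φ

/-- The terms of the truncated Koszul complex. -/
noncomputable abbrev koszulTerm (k : Type) [Field k] (x : Fin n ↪ σ) (m j : ℕ) :
    Submodule (MvPolynomial σ k) (Finset (Fin m) → MvPolynomial σ k) :=
  suppOn (fun I => I.card = j) (degGE (countWt x) (j + 1 - n))

variable {x φ}

lemma mem_koszulTerm {j : ℕ} {ω : Finset (Fin m) → MvPolynomial σ k} :
    ω ∈ koszulTerm k x m j ↔ IsForm j ω ∧ ∀ I, ω I ∈ degGE (countWt x) (j + 1 - n) :=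
  ⟨fun h => ⟨fun I hI => (h I).2 hI, fun I => (h I).1⟩, fun h I => ⟨h.2 I, h.1 I⟩⟩

lemma isWeightedHomogeneous_zVec (hφ : ∀ i j, IsWeightedHomogeneous (countWt x) (φ i j) 0)
    (j : Fin m) : IsWeightedHomogeneous (countWt x) (zVec x φ j) 1 := by
  have : zVec x φ j = ∑ i, X (x i) * φ i j := rfl
  rw [this]
  refine (weightedHomogeneousSubmodule k (countWt x) 1).sum_mem fun i _ => ?_
  have h := (isWeightedHomogeneous_X k (countWt x) (x i)).mul (hφ i j)
  rwa [countWt_apply] at h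

lemma wedgeV_mem_koszulTerm (hφ : ∀ i j, IsWeightedHomogeneous (countWt x) (φ i j) 0) {j : ℕ}
    {ω : Finset (Fin m) → MvPolynomial σ k} (hω : ω ∈ koszulTerm k x m j) :
    wedgeV _ _ (zVec x φ) ω ∈ koszulTerm k x m (j + 1) := by
  rw [mem_koszulTerm] at hω ⊢
  refine ⟨hω.1.wedgeV _, fun I => ?_⟩
  rw [wedgeV_apply]
  refine sum_mem fun i _ => ?_
  rw [mul_comm, mul_smul]
  refine Ideal.mul_mem_left _ _ ?_
  exact degGE_anti _ (by omega) (mul_mem_degGE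
    (isWeightedHomogeneous_zVec hφ i).mem_degGE (hω.2 _))

lemma contr_mem_koszulTerm {j : ℕ} {e : ℕ} (i : Fin m)
    {ω : Finset (Fin m) → MvPolynomial σ k} (hω : IsForm (j + 1) ω)
    (hω' : ∀ I, ω I ∈ degGE (countWt x) e) (he : j + 1 - n ≤ e) :
    contr (MvPolynomial σ k) _ i ω ∈ koszulTerm k x m j := by
  rw [mem_koszulTerm]
  refine ⟨hω.contr i, fun I => ?_⟩
  rw [contr_apply]
  split_ifs
  · exact zero_mem _
  · exact Ideal.mul_mem_left _ _ (degGE_anti _ he (hω' _))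

/-- The differential of the truncated Koszul complex. -/
noncomputable def koszulD (hφ : ∀ i j, IsWeightedHomogeneous (countWt x) (φ i j) 0) (j : ℕ) :
    koszulTerm k x m j →ₗ[MvPolynomial σ k] koszulTerm k x m (j + 1) :=
  (wedgeV _ _ (zVec x φ)).restrict fun _ h => wedgeV_mem_koszulTerm hφ h

variable (hφ : ∀ i j, IsWeightedHomogeneous (countWt x) (φ i j) 0)

lemma koszulD_coe (j : ℕ) (ω : koszulTerm k x m j) :
    (koszulD hφ j ω).1 = wedgeV _ _ (zVec x φ) ω.1 := rfl

lemma koszulD_koszulD (j : ℕ) (ω : koszulTerm k x m j) :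
    koszulD hφ (j + 1) (koszulD hφ j ω) = 0 := by
  refine Subtype.ext ?_
  rw [koszulD_coe, koszulD_coe, ← Module.End.mul_apply, wedgeV_mul_self]
  rfl

lemma mem_cob_koszulD_succ {j : ℕ} {ω : koszulTerm k x m (j + 1)} :
    ω ∈ cob (koszulD hφ) (j + 1) ↔
      ∃ η ∈ koszulTerm k x m j, wedgeV _ _ (zVec x φ) η = ω.1 :=
  ⟨fun ⟨η, h⟩ => ⟨η.1, η.2, congrArg Subtype.val h⟩, fun ⟨η, h, h'⟩ => ⟨⟨η, h⟩, Subtype.ext h'⟩⟩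

lemma zVec_smul_mem_cob {j : ℕ} (i : Fin m) {ω : koszulTerm k x m j}
    (hω : koszulD hφ j ω = 0) : zVec x φ i • ω ∈ cob (koszulD hφ) j := by
  have h := smul_eq_wedgeV_contr (zVec x φ) i (ω := ω.1) (congrArg Subtype.val hω)
  have hmem := mem_koszulTerm.1 ω.2
  cases j with
  | zero =>
    rw [hmem.1.contr_zero, map_zero] at h
    exact Subtype.ext h
  | succ j =>
    exact (mem_cob_koszulD_succ hφ).2
      ⟨_, contr_mem_koszulTerm i hmem.1 hmem.2 (by omega), h.symm⟩

lemma wedgeV_truncGE (hφ : ∀ i j, IsWeightedHomogeneous (countWt x) (φ i j) 0) (e : ℕ) (η : Finset (Fin m) → MvPolynomial σ k) (I : Finset (Fin m)) :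
    wedgeV _ _ (zVec x φ) (fun J => truncGE (countWt x) e (η J)) I =
      truncGE (countWt x) (1 + e) (wedgeV _ _ (zVec x φ) η I) := by
  rw [wedgeV_apply, wedgeV_apply, map_sum]
  refine Finset.sum_congr rfl fun j _ => ?_
  have hs : IsWeightedHomogeneous (countWt x)
      (zVec x φ j * ksign (MvPolynomial σ k) j I) (1 + 0) := by
    refine (isWeightedHomogeneous_zVec hφ j).mul ?_
    rw [ksign]
    have := (isWeightedHomogeneous_C (countWt x) ((-1 : k) ^ (I.filter (· < j)).card))
    simpa using this
  exact (truncGE_mul hs e _).symm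

lemma minor_pow_smul_mem_cob {j : ℕ} (c : Fin n ↪ Fin m) {ω : koszulTerm k x m j}
    (hω : koszulD hφ j ω = 0) :
    ∃ s : ℕ, (φ.submatrix id c).det ^ s • ω ∈ cob (koszulD hφ) j := by
  have hmem := mem_koszulTerm.1 ω.2
  obtain ⟨s, η, hη⟩ := exists_minor_pow_smul_eq x.injective φ c hmem.1
    (congrArg Subtype.val hω) fun hj I d hd => by
      refine exists_ne_zero_of_weight_countWt_ne_zero fun h0 => ?_
      exact mem_support_iff.1 hd (hmem.2 I d (by omega))
  replace hη : (φ.submatrix id c).det ^ s • ω.1 = wedgeV _ _ (zVec x φ) η := hη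
  refine ⟨s, ?_⟩
  cases j with
  | zero =>
    refine Subtype.ext ?_
    have h := congrArg (formPart (MvPolynomial σ k) (MvPolynomial σ k) m 0) hη
    rw [formPart_zero_wedgeV, (hmem.1.smul _).formPart_eq] at h
    exact h
  | succ j =>
    have h := congrArg (formPart (MvPolynomial σ k) (MvPolynomial σ k) m (j + 1)) hη
    rw [formPart_wedgeV, (hmem.1.smul _).formPart_eq] at h
    refine (mem_cob_koszulD_succ hφ).2 ?_
    by_cases hj : n ≤ j + 1
    · refine ⟨fun J => truncGE (countWt x) (j + 1 - n) (formPart (MvPolynomial σ k) _ m j η J),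
        mem_koszulTerm.2 ⟨fun I hI => ?_, fun I => truncGE_mem _ _ _⟩, ?_⟩
      · dsimp only
        rw [isForm_formPart j η I hI, map_zero]
      · funext I
        rw [wedgeV_truncGE hφ, ← h]
        refine truncGE_eq_self (Ideal.mul_mem_left _ _ ?_)
        have := hmem.2 I
        rwa [show j + 1 + 1 - n = 1 + (j + 1 - n) by omega] at this
    · refine ⟨_, mem_koszulTerm.2 ⟨isForm_formPart j η, fun I => ?_⟩, h.symm⟩
      rw [show j + 1 - n = 0 by omega, degGE_zero]
      trivial

end Complexes

section Comparison

variable {k σ : Type} [Field k] [DecidableEq σ] {n m : ℕ} {x : Fin n ↪ σ}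
  {φ : Matrix (Fin n) (Fin m) (MvPolynomial σ k)}

/-- The terms of the Koszul complex on `x` with coefficients in the exterior algebra. -/
noncomputable abbrev coeffTerm (k σ : Type) [Field k] (n m j : ℕ) :
    Submodule (MvPolynomial σ k) (Finset (Fin n) → Finset (Fin m) → MvPolynomial σ k) :=
  suppOn (fun I => I.card + j = n) ⊤

omit [DecidableEq σ] in
lemma contrV_mem_coeffTerm (a : Fin n → MvPolynomial σ k) {j : ℕ}
    {ρ : Finset (Fin n) → Finset (Fin m) → MvPolynomial σ k} (hρ : ρ ∈ coeffTerm k σ n m j) :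
    contrV _ _ a ρ ∈ coeffTerm k σ n m (j + 1) := by
  refine fun I => ⟨trivial, fun hI => ?_⟩
  rw [contrV_apply]
  refine Finset.sum_eq_zero fun i hi => ?_
  rw [(hρ (insert i I)).2, smul_zero]
  have := Finset.card_insert_of_notMem (Finset.mem_compl.1 hi)
  dsimp only at hI ⊢
  omega

/-- The differential of the Koszul complex on `x`. -/
noncomputable def coeffD (m : ℕ) (a : Fin n → MvPolynomial σ k) (j : ℕ) :
    coeffTerm k σ n m j →ₗ[MvPolynomial σ k] coeffTerm k σ n m (j + 1) :=
  (contrV _ _ a).restrict fun _ h => contrV_mem_coeffTerm a h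

omit [DecidableEq σ] in
lemma coeffD_coe (a : Fin n → MvPolynomial σ k) (j : ℕ) (ρ : coeffTerm k σ n m j) :
    (coeffD m a j ρ).1 = contrV _ _ a ρ.1 := rfl

omit [DecidableEq σ] in
lemma coeffD_coeffD (a : Fin n → MvPolynomial σ k) (j : ℕ) (ρ : coeffTerm k σ n m j) :
    coeffD m a (j + 1) (coeffD m a j ρ) = 0 := by
  refine Subtype.ext ?_
  rw [coeffD_coe, coeffD_coe, ← Module.End.mul_apply, contrV_mul_self]
  rfl

omit [DecidableEq σ] in
lemma dbar_coeffD_injective {j : ℕ} (hj : j < n) :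
    Function.Injective (dbar (coeffD_coeffD (m := m) (xVec k x)) j) := by
  rw [dbar_injective_iff]
  intro ρ hρ
  have hform : IsForm (n - j - 1 + 1) ρ.1 := fun I hI => (ρ.2 I).2 (by omega)
  obtain ⟨η, hη, hρη⟩ := exists_isForm_eq_contrV x.injective hform (congrArg Subtype.val hρ)
  cases j with
  | zero =>
    rw [hη.eq_zero_of_lt (by omega), map_zero] at hρη
    exact Subtype.ext hρη
  | succ j =>
    exact ⟨⟨η, fun I => ⟨trivial, fun hI => hη I (by omega)⟩⟩, Subtype.ext hρη.symm⟩

variable (x φ) in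
/-- The comparison map from the truncated Koszul complex. -/
noncomputable def comparison (j : ℕ) :
    koszulTerm k x m j →ₗ[MvPolynomial σ k] coeffTerm k σ n m j :=
  suppProj _ _ _ ∘ₗ compOp (fun i => wedgeV (MvPolynomial σ k) (MvPolynomial σ k) (φ i))
    (List.finRange n) ∘ₗ vac _ _ n ∘ₗ Submodule.subtype _

lemma comparison_apply {j : ℕ} (ω : koszulTerm k x m j) {I : Finset (Fin n)}
    (hI : I.card + j = n) : (comparison x φ j ω).1 I =
      compOp (fun i => wedgeV (MvPolynomial σ k) (MvPolynomial σ k) (φ i))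
        (List.finRange n) (vac (MvPolynomial σ k) _ n ω.1) I :=
  suppProj_apply_of (P := fun I : Finset (Fin n) => I.card + j = n) hI _

lemma contrV_comparison {j : ℕ} (ω : koszulTerm k x m j) {I : Finset (Fin n)}
    (hI : I.card + (j + 1) = n) :
    contrV (MvPolynomial σ k) _ (xVec k x) (comparison x φ j ω).1 I =
      compOp (fun i => wedgeV (MvPolynomial σ k) (MvPolynomial σ k) (φ i))
        (List.finRange n)
        (vac (MvPolynomial σ k) _ n (wedgeV _ (MvPolynomial σ k) (zVec x φ) ω.1)) I := by
  rw [contrV_congr _ fun J hJ => comparison_apply ω (by omega), zVec, wedgeV_vecMul]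
  exact congrFun (contrV_compOp_vac (fun i j => wedgeV_mul_wedgeV _ _)
    (fun i => wedgeV_mul_self _) _ _) I

lemma comparison_koszulD (hφ : ∀ i j, IsWeightedHomogeneous (countWt x) (φ i j) 0) (j : ℕ)
    (ω : koszulTerm k x m j) :
    comparison x φ (j + 1) (koszulD hφ j ω) = coeffD m (xVec k x) j (comparison x φ j ω) := by
  refine Subtype.ext (funext fun I => ?_)
  by_cases hI : I.card + (j + 1) = n
  · rw [comparison_apply _ hI, coeffD_coe, contrV_comparison _ hI, koszulD_coe]
  · rw [((comparison x φ (j + 1) (koszulD hφ j ω)).2 I).2 hI,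
      ((coeffD m (xVec k x) j (comparison x φ j ω)).2 I).2 hI]

lemma comparison_zero_mem (ω : koszulTerm k x m 0) (I : Finset (Fin n)) (J : Finset (Fin m)) :
    (comparison x φ 0 ω).1 I J ∈ minorsIdeal n φ := by
  by_cases hI : I.card + 0 = n
  · have hu : I = (List.finRange n).toFinset := by
      rw [List.toFinset_finRange, ← Finset.card_eq_iff_eq_univ, Fintype.card_fin]
      exact hI
    obtain ⟨-, u, hu'⟩ := compOp_vac_top (n := n)
      (e := fun i => wedgeV (MvPolynomial σ k) (MvPolynomial σ k) (φ i))
      (List.finRange n) (List.nodup_finRange n) ω.1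
    rw [comparison_apply _ hI, hu, hu']
    exact Ideal.mul_mem_left _ _ (prod_wedgeV_mem φ (fun c => det_mem_minorsIdeal c)
      (mem_koszulTerm.1 ω.2).1 J)
  · rw [((comparison x φ 0 ω).2 I).2 hI]
    exact zero_mem _

lemma map_comparison_mem (ω : koszulTerm k x m 0)
    (h : coeffTerm k σ n m 0 →ₗ[MvPolynomial σ k] MvPolynomial σ k) :
    h (comparison x φ 0 ω) ∈ minorsIdeal n φ := by
  have key : ∀ I, (comparison x φ 0 ω).1 I ∈
      minorsIdeal n φ • (⊤ : Submodule _ (Finset (Fin m) → MvPolynomial σ k)) :=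
    fun I => mem_smul_top_pi_iff.2 (comparison_zero_mem ω I)
  exact map_mem_of_forall_mem_smul_top (A := minorsIdeal n φ) rfl _ key h

variable (x) in
/-- The last map in the comparison with the Koszul complex on `x`. -/
noncomputable def lastMap (m N : ℕ) (hN : n = N + 1) :
    coeffTerm k σ n m N →ₗ[MvPolynomial σ k] koszulTerm k x m (N + 1) where
  toFun ρ := ⟨formPart (MvPolynomial σ k) _ m (N + 1) (contrV _ _ (xVec k x) ρ.1 ∅),
    mem_koszulTerm.2 ⟨isForm_formPart _ _, fun I => by
      rw [formPart_apply]
      split_ifs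
      · rw [contrV_apply, Finset.sum_apply]
        refine sum_mem fun i _ => ?_
        rw [Pi.smul_apply, smul_eq_mul, mul_assoc]
        refine Ideal.mul_mem_right _ _ ?_
        rw [show N + 1 + 1 - n = 1 by omega]
        have := isWeightedHomogeneous_X k (countWt x) (x i)
        rw [countWt_apply] at this
        exact this.mem_degGE
      · exact zero_mem _⟩⟩
  map_add' ρ ρ' := Subtype.ext (by
    dsimp only
    rw [Submodule.coe_add, map_add, Pi.add_apply, map_add]; rfl)
  map_smul' c ρ := Subtype.ext (by
    dsimp only
    rw [Submodule.coe_smul, map_smul, Pi.smul_apply, map_smul]; rfl)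

lemma lastMap_coe {N : ℕ} (hN : n = N + 1) (ρ : coeffTerm k σ n m N) :
    (lastMap x m N hN ρ).1 =
      formPart (MvPolynomial σ k) _ m (N + 1) (contrV _ _ (xVec k x) ρ.1 ∅) := rfl

lemma lastMap_eq_zero {N : ℕ} (hN : n = N + 1) {ρ : coeffTerm k σ n m N}
    (hρ : ρ ∈ cob (coeffD m (xVec k x)) N) : lastMap x m N hN ρ = 0 := by
  refine Subtype.ext ?_
  rw [lastMap_coe]
  cases N with
  | zero =>
    obtain rfl : ρ = 0 := hρ
    rw [Submodule.coe_zero, map_zero, Pi.zero_apply, map_zero]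
    rfl
  | succ N =>
    obtain ⟨ρ, rfl⟩ := hρ
    rw [coeffD_coe, ← Module.End.mul_apply (contrV _ _ _), contrV_mul_self, LinearMap.zero_apply,
      Pi.zero_apply, map_zero]
    rfl

lemma lastMap_comparison {N : ℕ} (hN : n = N + 1)
    (hφ : ∀ i j, IsWeightedHomogeneous (countWt x) (φ i j) 0) (ω : koszulTerm k x m N) :
    lastMap x m N hN (comparison x φ N ω) = koszulD hφ N ω := by
  refine Subtype.ext ?_
  rw [lastMap_coe, contrV_comparison ω (by rw [Finset.card_empty]; omega), compOp_apply_empty,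
    koszulD_coe]
  have h : vac (MvPolynomial σ k) _ n (wedgeV _ (MvPolynomial σ k) (zVec x φ) ω.1) ∅ =
    wedgeV _ (MvPolynomial σ k) (zVec x φ) ω.1 := by simp [vac]
  rw [h, ((mem_koszulTerm.1 ω.2).1.wedgeV _).formPart_eq]

end Comparison

section Assembly

open CategoryTheory Abelian

variable {k σ : Type} [Field k] [DecidableEq σ] {n m : ℕ} {x : Fin n ↪ σ}
  {φ : Matrix (Fin n) (Fin m) (MvPolynomial σ k)}

lemma pdLT_koszulTerm_of_lt {j : ℕ} (hj : j < n) : PdLT (MvPolynomial σ k) (koszulTerm k x m j) 1 := by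
  refine pdLT_suppOn ?_
  rw [show j + 1 - n = 0 by omega, degGE_zero]
  exact pdLT_of_equiv Submodule.topEquiv.symm (pdLT_of_projective le_rfl)

lemma pdLT_koszulTerm (hn : 0 < n) (j : ℕ) : PdLT (MvPolynomial σ k) (koszulTerm k x m j) n :=
  pdLT_suppOn (pdLT_degGE_countWt x hn _)

omit [DecidableEq σ] in
lemma pdLT_coeffTerm (j : ℕ) : PdLT (MvPolynomial σ k) (coeffTerm k σ n m j) 1 :=
  pdLT_suppOn (pdLT_of_equiv Submodule.topEquiv.symm (pdLT_of_projective le_rfl))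

lemma single_empty_mem_koszulTerm (hn : 0 < n) (f : MvPolynomial σ k) :
    Pi.single ∅ f ∈ koszulTerm k x m 0 := by
  refine mem_koszulTerm.2 ⟨fun I hI => ?_, fun I => ?_⟩
  · have : I ≠ ∅ := by rintro rfl; simp at hI
    simp [this]
  · rw [show 0 + 1 - n = 0 by omega, degGE_zero]
    trivial

variable (k x m) in
/-- The Koszul complex starts with the ring. -/
noncomputable def koszulTermZeroEquiv (hn : 0 < n) :
    koszulTerm k x m 0 ≃ₗ[MvPolynomial σ k] MvPolynomial σ k where
  toFun ω := ω.1 ∅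
  map_add' _ _ := rfl
  map_smul' _ _ := rfl
  invFun f := ⟨Pi.single ∅ f, single_empty_mem_koszulTerm hn f⟩
  left_inv ω := by
    refine Subtype.ext (funext fun I => ?_)
    by_cases hI : I = ∅
    · subst hI; simp
    · have := (mem_koszulTerm.1 ω.2).1 I (by simpa using hI)
      simp [hI, this]
  right_inv f := by simp

lemma map_koszulD_zero_mem (hn : 1 < n)
    (hφ : ∀ i j, IsWeightedHomogeneous (countWt x) (φ i j) 0) (ω : koszulTerm k x m 0)
    (h : koszulTerm k x m 1 →ₗ[MvPolynomial σ k] MvPolynomial σ k) :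
    h (koszulD hφ 0 ω) ∈ Ideal.span (Set.range (zVec x φ)) := by
  have key : ∀ I, (koszulD hφ 0 ω).1 I ∈
      Ideal.span (Set.range (zVec x φ)) • (⊤ : Submodule (MvPolynomial σ k) (MvPolynomial σ k)) := by
    intro I
    rw [koszulD_coe, wedgeV_apply]
    refine sum_mem fun i _ => ?_
    exact Submodule.smul_mem_smul
      (Ideal.mul_mem_right _ _ (Ideal.subset_span ⟨i, rfl⟩)) trivial
  refine map_mem_of_forall_mem_smul_top (A := Ideal.span (Set.range (zVec x φ))) ?_ _ key h
  rw [show 0 + 1 + 1 - n = 0 by omega, degGE_zero]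

omit [DecidableEq σ] in
lemma minor_smul_xVec (c : Fin n ↪ Fin m) (i : Fin n) :
    (φ.submatrix id c).det * X (x i) =
      ∑ b, (φ.submatrix id c).adjugate b i * zVec x φ (c b) := by
  have h1 : Matrix.vecMul (xVec k x) (φ.submatrix id c) = fun b => zVec x φ (c b) := rfl
  have h2 := congrFun (congrArg (Matrix.vecMul (xVec k x)) (Matrix.mul_adjugate
    (φ.submatrix id c))) i
  rw [← Matrix.vecMul_vecMul, h1, Matrix.vecMul_smul, Matrix.vecMul_one] at h2
  rw [Pi.smul_apply, smul_eq_mul] at h2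
  have h3 : Matrix.vecMul (fun b => zVec x φ (c b)) (φ.submatrix id c).adjugate i =
      ∑ b, zVec x φ (c b) * (φ.submatrix id c).adjugate b i := rfl
  exact (h2.symm.trans h3).trans (Finset.sum_congr rfl fun b _ => mul_comm _ _)

/-- Maximal minors multiply top forms into boundaries. -/
lemma exists_wedgeV_eq_minor_smul_single {M : ℕ} {x : Fin n ↪ σ}
    {φ : Matrix (Fin n) (Fin (M + 1)) (MvPolynomial σ k)} (c : Fin n ↪ Fin (M + 1))
    {f : MvPolynomial σ k} (hf : f ∈ degGE (countWt x) (M + 1 - n + 1)) :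
    ∃ η ∈ koszulTerm k x (M + 1) M, wedgeV _ _ (zVec x φ) η =
      (φ.submatrix id c).det • (Pi.single Finset.univ f : Finset (Fin (M + 1)) → _) := by
  let T : Submodule (MvPolynomial σ k) (MvPolynomial σ k) :=
    ((koszulTerm k x (M + 1) M).map (wedgeV _ _ (zVec x φ))).comap
      ((φ.submatrix id c).det •
        LinearMap.single (MvPolynomial σ k) (fun _ : Finset (Fin (M + 1)) => MvPolynomial σ k)
          Finset.univ)
  suffices h : f ∈ T from h
  have hz : ∀ (j : Fin (M + 1)) (g : MvPolynomial σ k), g ∈ degGE (countWt x) (M + 1 - n) →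
      zVec x φ j • (Pi.single Finset.univ g : Finset (Fin (M + 1)) → _) ∈
        (koszulTerm k x (M + 1) M).map (wedgeV _ (MvPolynomial σ k) (zVec x φ)) := by
    intro j g hg
    have hform : IsForm (M + 1) (Pi.single Finset.univ g : Finset (Fin (M + 1)) → _) := by
      intro I hI
      have : I ≠ Finset.univ := by rintro rfl; simp at hI
      simp [this]
    have h0 := (hform.wedgeV (zVec x φ)).eq_zero_of_lt (Nat.lt_succ_self _)
    refine ⟨_, contr_mem_koszulTerm j hform (fun I => ?_) le_rfl,
      (smul_eq_wedgeV_contr _ j h0).symm⟩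
    by_cases hI : I = Finset.univ
    · subst hI; simpa using hg
    · simp [hI]
  rw [f.as_sum]
  refine sum_mem fun d hd => ?_
  have hw : M + 1 - n + 1 ≤ Finsupp.weight (countWt x) d := by
    by_contra h
    exact mem_support_iff.1 hd (hf d (by omega))
  obtain ⟨a, ha⟩ := exists_ne_zero_of_weight_countWt_ne_zero
    (show Finsupp.weight (countWt x) d ≠ 0 by omega)
  have hd' : d - Finsupp.single (x a) 1 + Finsupp.single (x a) 1 = d :=
    tsub_add_cancel_of_le (Finsupp.single_le_iff.2 (Nat.one_le_iff_ne_zero.2 ha))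
  have hmon : monomial d (coeff d f) =
      X (x a) * monomial (d - Finsupp.single (x a) 1) (coeff d f) := by
    rw [X, monomial_mul, one_mul, add_comm, hd']
  have hg : monomial (d - Finsupp.single (x a) 1) (coeff d f) ∈
      degGE (countWt x) (M + 1 - n) := by
    rw [← X_mul_mem_degGE_iff (countWt_apply x a), ← hmon]
    exact degGE_anti _ hw (isWeightedHomogeneous_monomial _ _ _ rfl).mem_degGE
  rw [hmon]
  show (φ.submatrix id c).det • (Pi.single Finset.univ
      (X (x a) * monomial (d - Finsupp.single (x a) 1) (coeff d f) : MvPolynomial σ k) :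
        Finset (Fin (M + 1)) → MvPolynomial σ k) ∈
    (koszulTerm k x (M + 1) M).map (wedgeV _ (MvPolynomial σ k) (zVec x φ))
  rw [← smul_eq_mul (X (x a)), Pi.single_smul, smul_smul, minor_smul_xVec, Finset.sum_smul]
  refine sum_mem fun b _ => ?_
  rw [mul_smul]
  exact Submodule.smul_mem _ _ (hz _ _ hg)

/-- The last cokernel of the truncated Koszul complex is annihilated by the residual
intersection. -/
lemma le_annihilator_cok {M : ℕ} {x : Fin n ↪ σ} (hnM : n ≤ M + 1)
    {φ : Matrix (Fin n) (Fin (M + 1)) (MvPolynomial σ k)}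
    (hφ : ∀ i j, IsWeightedHomogeneous (countWt x) (φ i j) 0) :
    Ideal.span (Set.range (zVec x φ)) ⊔ minorsIdeal n φ ≤
      Module.annihilator (MvPolynomial σ k) (Cok (koszulD hφ) (M + 1)) := by
  have hD : ∀ ω : koszulTerm k x (M + 1) (M + 1), koszulD hφ (M + 1) ω = 0 := fun ω =>
    Subtype.ext (((mem_koszulTerm.1 ω.2).1.wedgeV _).eq_zero_of_lt (Nat.lt_succ_self _))
  refine sup_le (Ideal.span_le.2 ?_) (minorsIdeal_le fun c => ?_)
  · rintro _ ⟨i, rfl⟩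
    refine Module.mem_annihilator.2 fun w => ?_
    obtain ⟨ω, rfl⟩ := Submodule.Quotient.mk_surjective _ w
    rw [← Submodule.Quotient.mk_smul, Submodule.Quotient.mk_eq_zero]
    exact zVec_smul_mem_cob hφ i (hD ω)
  · refine Module.mem_annihilator.2 fun w => ?_
    obtain ⟨ω, rfl⟩ := Submodule.Quotient.mk_surjective _ w
    rw [← Submodule.Quotient.mk_smul, Submodule.Quotient.mk_eq_zero, mem_cob_koszulD_succ]
    have hω := mem_koszulTerm.1 ω.2
    have h1 : ω.1 = Pi.single Finset.univ (ω.1 Finset.univ) := by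
      funext I
      by_cases hI : I = Finset.univ
      · subst hI; simp
      · rw [Pi.single_eq_of_ne hI, hω.1 I fun h => hI ?_]
        rwa [← Finset.card_eq_iff_eq_univ, Fintype.card_fin]
    have h2 := hω.2 Finset.univ
    rw [show M + 1 + 1 - n = M + 1 - n + 1 by omega] at h2
    obtain ⟨η, hη, h⟩ := exists_wedgeV_eq_minor_smul_single (φ := φ) c h2
    exact ⟨η, hη, by rw [h, ← h1]; rfl⟩

end Assembly

section ProjectiveDimension

open CategoryTheory Abelian

lemma smul_ext_eq_zero_of_mem_annihilator {R : Type} [CommRing R] {W M : Type} [AddCommGroup W]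
    [Module R W] [AddCommGroup M] [Module R M] {i : ℕ} {f : R} (hf : f ∈ Module.annihilator R W)
    (c : Ext (ModuleCat.of R W) (ModuleCat.of R M) i) : f • c = 0 := by
  have h0 : f • 𝟙 (ModuleCat.of R W) = 0 := by
    ext w
    exact Module.mem_annihilator.1 hf w
  calc f • c = (Ext.mk₀ (f • 𝟙 (ModuleCat.of R W))).comp c (zero_add i) := by
        rw [Ext.mk₀_smul, Ext.smul_comp, Ext.mk₀_id_comp]
    _ = 0 := by rw [h0, Ext.mk₀_zero, Ext.zero_comp]

variable {k σ : Type} [Field k] [DecidableEq σ] [Finite σ] {N M : ℕ} {x : Fin (N + 1) ↪ σ}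
  {φ : Matrix (Fin (N + 1)) (Fin (M + 1)) (MvPolynomial σ k)}

/-- The truncated Koszul complex is exact up to its last term. -/
lemma dbar_koszulD_injective (hφ : ∀ i j, IsWeightedHomogeneous (countWt x) (φ i j) 0)
    {J : Ideal (MvPolynomial σ k)}
    (hJz : J = Ideal.span (Set.range (zVec x φ)) ⊔ minorsIdeal (N + 1) φ) (hJt : J ≠ ⊤)
    (hJ : ∀ P : Ideal (MvPolynomial σ k), P.IsPrime → J ≤ P → ((M + 1 : ℕ) : ℕ∞) ≤ P.height) :
    ∀ j < M + 1, Function.Injective (dbar (koszulD_koszulD hφ) j) := by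
  refine dbar_injective (koszulD_koszulD hφ)
    (G := Set.range (zVec x φ) ∪ Set.range fun c : Fin (N + 1) ↪ Fin (M + 1) =>
      (φ.submatrix id c).det) (fun T _ _ _ hT => ?_) (fun j _ => ?_) ?_
  · refine ExtZero.of_le_height hJ hJt (hT.trans fun P hP => ?_)
    refine (show J ≤ P.asIdeal from ?_)
    rw [hJz]
    exact sup_le (Ideal.span_le.2 fun f hf => hP (Or.inl hf))
      (minorsIdeal_le fun c => hP (Or.inr ⟨c, rfl⟩))
  · rcases lt_or_ge j (N + 1) with h | h
    · exact pdLT_mono (by omega) (pdLT_koszulTerm_of_lt h)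
    · exact pdLT_mono (by omega) (pdLT_koszulTerm N.succ_pos j)
  · rintro j - ω hω f (⟨i, rfl⟩ | ⟨c, rfl⟩)
    · exact ⟨1, by rw [pow_one]; exact zVec_smul_mem_cob hφ i hω⟩
    · exact minor_pow_smul_mem_cob hφ c hω

/-- The quotient by the residual intersection is an Ext module of the last cokernel
of the truncated Koszul complex. -/
lemma nonempty_ext_equiv_quotient (hNM : N ≤ M)
    (hφ : ∀ i j, IsWeightedHomogeneous (countWt x) (φ i j) 0)
    {J : Ideal (MvPolynomial σ k)}
    (hJz : J = Ideal.span (Set.range (zVec x φ)) ⊔ minorsIdeal (N + 1) φ) (hJt : J ≠ ⊤)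
    (hJ : ∀ P : Ideal (MvPolynomial σ k), P.IsPrime → J ≤ P → ((M + 1 : ℕ) : ℕ∞) ≤ P.height) :
    Nonempty (Ext (ModuleCat.of (MvPolynomial σ k) (Cok (koszulD hφ) (M + 1)))
      (ModuleCat.of (MvPolynomial σ k) (MvPolynomial σ k)) (M + 1) ≃ₗ[MvPolynomial σ k]
        (MvPolynomial σ k ⧸ J)) := by
  obtain ⟨c, hc, hcJ, -⟩ := exists_ext_generator (koszulD_koszulD hφ)
    (coeffD_coeffD (m := M + 1) (xVec k x)) (N := N)
    (Z := Ideal.span (Set.range (zVec x φ))) (I := minorsIdeal (N + 1) φ)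
    (dbar_koszulD_injective hφ hJz hJt hJ)
    (fun j hj => dbar_coeffD_injective (by omega))
    (fun j hj => pdLT_koszulTerm_of_lt (by omega))
    (fun j _ => pdLT_koszulTerm N.succ_pos j) pdLT_coeffTerm
    (α := comparison x φ) (comparison_koszulD hφ) (koszulTermZeroEquiv k (M + 1) x N.succ_pos)
    (fun hN h => map_koszulD_zero_mem (by omega) hφ _ h) (fun h => map_comparison_mem _ h)
    (β := lastMap x (M + 1) N rfl) (fun ρ hρ => lastMap_eq_zero rfl hρ)
    (fun ω => lastMap_comparison rfl hφ ω) (M + 1) le_rfl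
  let g := LinearMap.toSpanSingleton (MvPolynomial σ k)
    (Ext (ModuleCat.of (MvPolynomial σ k) (Cok (koszulD hφ) (M + 1)))
      (ModuleCat.of (MvPolynomial σ k) (MvPolynomial σ k)) (M + 1)) c
  have hg : Function.Surjective g := fun y => (hc y).imp fun f hf => hf.symm
  have hker : LinearMap.ker g = J := by
    ext f
    rw [LinearMap.mem_ker, hJz]
    exact ⟨hcJ f, fun hf =>
      smul_ext_eq_zero_of_mem_annihilator (le_annihilator_cok (by omega) hφ hf) c⟩
  exact ⟨((Submodule.quotEquivOfEq _ _ hker.symm).trans (g.quotKerEquivOfSurjective hg)).symm⟩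

/-- The projective dimension of the quotient by the residual intersection. -/
theorem hasFreeResLE_quotient_and_not (hNM : N ≤ M)
    (hφ : ∀ i j, IsWeightedHomogeneous (countWt x) (φ i j) 0)
    {J : Ideal (MvPolynomial σ k)}
    (hJz : J = Ideal.span (Set.range (zVec x φ)) ⊔ minorsIdeal (N + 1) φ) (hJt : J ≠ ⊤)
    (hJ : ∀ P : Ideal (MvPolynomial σ k), P.IsPrime → J ≤ P → ((M + 1 : ℕ) : ℕ∞) ≤ P.height) :
    HasFreeResLE (MvPolynomial σ k) (MvPolynomial σ k ⧸ J) (M + 1) ∧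
      ¬ HasFreeResLE (MvPolynomial σ k) (MvPolynomial σ k ⧸ J) M := by
  have hinj := dbar_koszulD_injective hφ hJz hJt hJ
  constructor
  · have hE : ∀ i < M + 1, ExtZero (MvPolynomial σ k) (Cok (koszulD hφ) (M + 1))
        (MvPolynomial σ k) i := by
      refine ExtZero.of_le_height hJ hJt ?_
      rw [Module.support_eq_zeroLocus]
      refine PrimeSpectrum.zeroLocus_anti_mono ?_
      rw [hJz]
      exact le_annihilator_cok (by omega) hφ
    have hW : PdLT (MvPolynomial σ k) (Cok (koszulD hφ) (M + 1)) (M + 1 + 1) := by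
      refine pdLT_cok (koszulD_koszulD hφ) hinj (fun j _ => ?_) (M + 1) le_rfl
      rcases lt_or_ge j (N + 1) with h | h
      · exact pdLT_mono (by omega) (pdLT_koszulTerm_of_lt h)
      · exact pdLT_mono (by omega) (pdLT_koszulTerm N.succ_pos j)
    have hD : PdLT (MvPolynomial σ k)
        (Cok (koszulD hφ) (M + 1) →ₗ[MvPolynomial σ k] MvPolynomial σ k) 0 :=
      pdLT_zero_iff.2 ⟨fun a b => by
        rw [(hE 0 M.succ_pos).linearMap_eq_zero a, (hE 0 M.succ_pos).linearMap_eq_zero b]⟩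
    obtain ⟨e⟩ := nonempty_ext_equiv_quotient hNM hφ hJz hJt hJ
    have h := pdLT_of_equiv e (pdLT_ext hD hW fun i _ hi => hE i hi)
    exact hasFreeResLE_of_pdLT (pdLT_mono (by omega) h)
  · intro h
    have hsub : Subsingleton (MvPolynomial σ k ⧸ J) := by
      refine subsingleton_of_pdLT_of_extZero (ExtZero.of_le_height hJ hJt ?_) h.pdLT
      rw [Module.support_eq_zeroLocus, Ideal.annihilator_quotient]
    exact hJt (Ideal.Quotient.subsingleton_iff.1 hsub)

end ProjectiveDimension

section Bigrading

variable {k : Type} [Field k] {n m p : ℕ} {φ : Matrix (Fin n) (Fin m) (PolyS k n p)}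

lemma isWeightedHomogeneous_countWt_of_mem_piece {f : PolyS k n p}
    (hf : f ∈ piece k n p (0, 1)) :
    IsWeightedHomogeneous (countWt (Function.Embedding.inl : Fin n ↪ Fin n ⊕ Fin p)) f 0 := by
  intro d hd
  have h := hf hd
  have h1 : ∑ a : Fin n, (d (Sum.inl a) : ℤ) = 0 := by
    have := congrArg Prod.fst h
    rw [Finsupp.weight_apply, Finsupp.sum_fintype _ _ (by simp)] at this
    simpa [bideg, Prod.fst_sum] using this
  by_contra h0
  obtain ⟨a, ha⟩ := exists_ne_zero_of_weight_countWt_ne_zero h0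
  exact ha (by
    have := (Finset.sum_eq_zero_iff_of_nonneg (fun a _ => by positivity)).1 h1 a
      (Finset.mem_univ a)
    exact_mod_cast this)

lemma constantCoeff_eq_zero_of_mem_piece {f : PolyS k n p} (hf : f ∈ piece k n p (0, 1)) :
    constantCoeff f = 0 := by
  by_contra h
  have := hf (d := 0) h
  simp [Prod.ext_iff] at this

lemma resJ_ne_top (hn : 0 < n) (hφ : ∀ i j, φ i j ∈ piece k n p (0, 1)) :
    resJ k n m p φ ≠ ⊤ := by
  have hle : resJ k n m p φ ≤ RingHom.ker (constantCoeff : PolyS k n p →+* k) := by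
    refine sup_le (Ideal.span_le.2 ?_) (minorsIdeal_le fun c => ?_)
    · rintro _ ⟨j, rfl⟩
      simp [zseq, RingHom.mem_ker]
    · have : Nonempty (Fin n) := ⟨⟨0, hn⟩⟩
      have h0 : (constantCoeff : PolyS k n p →+* k).mapMatrix (φ.submatrix id c) = 0 := by
        ext i j
        exact constantCoeff_eq_zero_of_mem_piece (hφ i (c j))
      rw [RingHom.mem_ker, RingHom.map_det, h0, Matrix.det_zero]
  exact fun h => RingHom.ker_ne_top _ (top_le_iff.1 (h ▸ hle))

lemma le_height_of_le_idealHeight {R : Type} [CommRing R] {J : Ideal R} {t : ℕ∞}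
    (h : t ≤ idealHeight J) (P : Ideal R) (hP : P.IsPrime) (hJ : J ≤ P) : t ≤ P.height := by
  change t ≤ (⟨P, hP⟩ : PrimeSpectrum R).asIdeal.height
  rw [PrimeSpectrum.height_eq_orderHeight]
  exact h.trans (iInf₂_le (⟨P, hP⟩ : PrimeSpectrum R) hJ)

end Bigrading

/-- Under the residual-intersection hypotheses, the projective
dimension of `S/J` as an `S`-module equals `m`: `S/J` has a free resolution of length
`m` but none of length `m - 1`. -/
theorem stmt3
    (k : Type) [Field k] (n m p : ℕ)
    (hn : 0 < n) (hp : 0 < p) (hnm : n ≤ m)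
    (φ : Matrix (Fin n) (Fin m) (PolyS k n p))
    (hφ : ∀ i j, φ i j ∈ piece k n p (0, 1))
    (hgrade : gradeGE (minorsIdeal n φ) (m - n + 1))
    (hhtJ : (m : ℕ∞) ≤ idealHeight (resJ k n m p φ))
    (hgeom : geomResCond k n m p φ) :
    HasFreeResLE (PolyS k n p) (PolyS k n p ⧸ resJ k n m p φ) m ∧
      ¬ HasFreeResLE (PolyS k n p) (PolyS k n p ⧸ resJ k n m p φ) (m - 1) := by
  obtain ⟨N, rfl⟩ := Nat.exists_eq_succ_of_ne_zero hn.ne'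
  obtain ⟨M, rfl⟩ := Nat.exists_eq_succ_of_ne_zero (hn.trans_le hnm).ne'
  exact hasFreeResLE_quotient_and_not (x := Function.Embedding.inl) (φ := φ)
    (by omega) (fun i j => isWeightedHomogeneous_countWt_of_mem_piece (hφ i j)) rfl
    (resJ_ne_top hn hφ) (le_height_of_le_idealHeight hhtJ)
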